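/- If H is a generalized Halin graph with maximum degree Δ ≥ 13, then ch'_star(H) ≤ ⌊3Δ/2⌋, and this bound is tight: there exist generalized Halin graphs H with ch'_star(H) = χ'_star(H) = ⌊3Δ/2⌋. -/

import Mathlib

open SimpleGraph
open scoped Classical

/-- Two edges (as unordered pairs of vertices) are adjacent:
they are distinct and share an endpoint. -/
def EdgeAdj {V : Type*} (e₁ e₂ : Sym2 V) : Prop :=
  e₁ ≠ e₂ ∧ ∃ v, v ∈ e₁ ∧ v ∈ e₂

/-- `φ` is a star edge coloring of `G`: a proper edge coloring such that
no path of length four and no cycle of length four is bichromatic. -/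
def IsStarEdgeColoring {V : Type*} (G : SimpleGraph V) (φ : Sym2 V → ℕ) : Prop :=
  (∀ e₁ ∈ G.edgeSet, ∀ e₂ ∈ G.edgeSet, EdgeAdj e₁ e₂ → φ e₁ ≠ φ e₂) ∧
  (∀ (u v : V) (p : G.Walk u v), p.IsPath → p.length = 4 →
      ¬ ∃ c₁ c₂ : ℕ, ∀ e ∈ p.edges, φ e = c₁ ∨ φ e = c₂) ∧
  (∀ (u : V) (p : G.Walk u u), p.IsCycle → p.length = 4 →
      ¬ ∃ c₁ c₂ : ℕ, ∀ e ∈ p.edges, φ e = c₁ ∨ φ e = c₂)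

/-- `G` has a star edge coloring using colors `< k`. -/
def StarColorable {V : Type*} (G : SimpleGraph V) (k : ℕ) : Prop :=
  ∃ φ : Sym2 V → ℕ, (∀ e ∈ G.edgeSet, φ e < k) ∧ IsStarEdgeColoring G φ

/-- The star chromatic index of `G`. -/
noncomputable def starChromaticIndex {V : Type*} (G : SimpleGraph V) : ℕ :=
  sInf {k | StarColorable G k}

/-- `G` is star `k`-edge choosable. -/
def StarChoosable {V : Type*} (G : SimpleGraph V) (k : ℕ) : Prop :=
  ∀ L : Sym2 V → Finset ℕ, (∀ e ∈ G.edgeSet, k ≤ (L e).card) →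
    ∃ φ : Sym2 V → ℕ, (∀ e ∈ G.edgeSet, φ e ∈ L e) ∧ IsStarEdgeColoring G φ

/-- The list star chromatic index of `G`. -/
noncomputable def listStarChromaticIndex {V : Type*} (G : SimpleGraph V) : ℕ :=
  sInf {k | StarChoosable G k}

/-- The maximum Ore-degree `θ(G) = max_{xy ∈ E(G)} (d(x) + d(y))`. -/
noncomputable def oreDegree {V : Type*} (G : SimpleGraph V) [Fintype V] : ℕ :=
  sSup {n | ∃ x y, G.Adj x y ∧ n = G.degree x + G.degree y}

/-- `H = T ∪ C` is a generalized Halin graph with characteristic tree `T` and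
adjoint cycle `C`: `T` is a tree with `Δ(T) ≥ 3`, `C` is a cycle (a connected
`2`-regular subgraph on its support) passing exactly through the leaves of `T`,
the edges of `T` and `C` are disjoint, and `H` is their union. -/
def IsGenHalin {V : Type*} [Fintype V] (H T C : SimpleGraph V) : Prop :=
  T.IsTree ∧ 3 ≤ T.maxDegree ∧ H = T ⊔ C ∧ Disjoint T.edgeSet C.edgeSet ∧
  (∀ v, T.degree v = 1 ↔ C.degree v = 2) ∧
  (∀ v, C.degree v = 0 ∨ C.degree v = 2) ∧
  (∀ u v, C.degree u = 2 → C.degree v = 2 → C.Reachable u v)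

/-- A Halin graph: a generalized Halin graph whose characteristic tree has
no vertex of degree `2`. -/
def IsHalin {V : Type*} [Fintype V] (H T C : SimpleGraph V) : Prop :=
  IsGenHalin H T C ∧ ∀ v, T.degree v ≠ 2

/-- A complete Halin graph: all leaves of `T` are at the same distance
from the root. -/
def IsCompleteHalin {V : Type*} [Fintype V] (H T C : SimpleGraph V) : Prop :=
  IsHalin H T C ∧
    ∃ r, ∀ u v, T.degree u = 1 → T.degree v = 1 → T.dist r u = T.dist r v

/-! ### List colouring of the cycle edges -/

theorem hal_val_add {l : ℕ} [NeZero l] (j : ZMod l) (m : ℕ) (hm : m < l) :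
    (j + (m : ZMod l)).val = if j.val + m < l then j.val + m else j.val + m - l := by
  have hj := ZMod.val_lt j
  rw [ZMod.val_add, ZMod.val_natCast, Nat.mod_eq_of_lt hm]
  split_ifs with h
  · exact Nat.mod_eq_of_lt h
  · rw [Nat.mod_eq_sub_mod (by omega), Nat.mod_eq_of_lt (by omega)]

/-- Conditions for a good colouring of a cycle, positions `0, …, l-1`. -/
def HalCyc (l : ℕ) (f : ℕ → ℕ) : Prop :=
  (∀ k, k + 1 < l → f k ≠ f (k + 1)) ∧ f (l - 1) ≠ f 0 ∧
  (∀ k, k + 3 < l → ¬ (f k = f (k + 2) ∧ f (k + 1) = f (k + 3))) ∧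
  ¬ (f (l - 3) = f (l - 1) ∧ f (l - 2) = f 0) ∧
  ¬ (f (l - 2) = f 0 ∧ f (l - 1) = f 1) ∧
  ¬ (f (l - 1) = f 1 ∧ f 0 = f 2)

theorem hal_cyc_transfer {l : ℕ} [NeZero l] (hl : 8 ≤ l) (f : ℕ → ℕ) (hf : HalCyc l f)
    (i : ZMod l) :
    f i.val ≠ f (i + 1).val ∧
      ¬ (f i.val = f (i + 2).val ∧ f (i + 1).val = f (i + 3).val) := by
  obtain ⟨h1, h2, h3, h4, h5, h6⟩ := hf
  have e1 := hal_val_add i 1 (by omega)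
  have e2 := hal_val_add i 2 (by omega)
  have e3 := hal_val_add i 3 (by omega)
  have hj := ZMod.val_lt i
  push_cast at e1 e2 e3
  rw [e1, e2, e3]
  generalize i.val = k at *
  constructor
  · split_ifs with h
    · exact h1 k h
    · have : k = l - 1 := by omega
      subst this
      have : l - 1 + 1 - l = 0 := by omega
      rw [this]; exact h2
  · by_cases c3 : k + 3 < l
    · rw [if_pos (by omega), if_pos (by omega), if_pos (by omega)]
      exact h3 k c3
    · have : k = l - 3 ∨ k = l - 2 ∨ k = l - 1 := by omega
      rcases this with rfl | rfl | rfl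
      · rw [if_pos (by omega), if_pos (by omega), if_neg (by omega)]
        have a1 : l - 3 + 2 = l - 1 := by omega
        have a2 : l - 3 + 1 = l - 2 := by omega
        have a3 : l - 3 + 3 - l = 0 := by omega
        rw [a1, a2, a3]; exact h4
      · rw [if_neg (by omega), if_pos (by omega), if_neg (by omega)]
        have a1 : l - 2 + 2 - l = 0 := by omega
        have a2 : l - 2 + 1 = l - 1 := by omega
        have a3 : l - 2 + 3 - l = 1 := by omega
        rw [a1, a2, a3]; exact h5
      · rw [if_neg (by omega), if_neg (by omega), if_neg (by omega)]
        have a1 : l - 1 + 2 - l = 1 := by omega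
        have a2 : l - 1 + 1 - l = 0 := by omega
        have a3 : l - 1 + 3 - l = 2 := by omega
        rw [a1, a2, a3]; exact h6

theorem hal_pick (S : Finset ℕ) (hS : 3 ≤ S.card) (a b : ℕ) : ∃ z ∈ S, z ≠ a ∧ z ≠ b := by
  have h1 : ({a, b} : Finset ℕ).card ≤ 2 := Finset.card_le_two
  obtain ⟨z, hz, hz2⟩ := Finset.exists_mem_notMem_of_card_lt_card (s := {a, b}) (t := S) (by omega)
  exact ⟨z, hz, by simpa using hz2⟩

theorem hal_cyc_greedy (l : ℕ) (hl : 8 ≤ l) (M : ℕ → Finset ℕ) (hM : ∀ k, 3 ≤ (M k).card)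
    (a : ℕ) (ha : a ∈ M 0) (ha' : a ∉ M (l - 1)) :
    ∃ f : ℕ → ℕ, (∀ k < l, f k ∈ M k) ∧ HalCyc l f := by
  choose pick hp1 hp2 hp3 using fun k => hal_pick (M k) (hM k)
  let g : ℕ → ℕ × ℕ := fun n => Nat.rec (a, a) (fun n p => (p.2, pick (n + 1) p.1 p.2)) n
  have g0 : g 0 = (a, a) := rfl
  have gs : ∀ n, g (n + 1) = ((g n).2, pick (n + 1) (g n).1 (g n).2) := fun n => rfl
  let f : ℕ → ℕ := fun n => (g n).2
  have f0 : f 0 = a := rfl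
  have fm : ∀ n, f n ∈ M n := by
    intro n
    cases n with
    | zero => exact ha
    | succ n => exact hp1 _ _ _
  have fn1 : ∀ n, f (n + 1) ≠ f n := fun n => hp3 _ _ _
  have fn2 : ∀ n, f (n + 2) ≠ f n := fun n => hp2 _ _ _
  have key : ∃ z ∈ M (l - 1), z ≠ f (l - 2) ∧
      (f (l - 2) = f 0 → z ≠ f (l - 3) ∧ z ≠ f 1) := by
    by_cases h : f (l - 2) = f 0
    · obtain ⟨z, hz, h1, h2⟩ := hal_pick (M (l - 1)) (hM _) (f (l - 3)) (f 1)
      refine ⟨z, hz, ?_, fun _ => ⟨h1, h2⟩⟩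
      rw [h, f0]; rintro rfl; exact ha' hz
    · obtain ⟨z, hz, h1, h2⟩ := hal_pick (M (l - 1)) (hM _) (f (l - 2)) (f 1)
      exact ⟨z, hz, h1, fun h' => absurd h' h⟩
  obtain ⟨z, hz, hz1, hz2⟩ := key
  have hz0 : z ≠ f 0 := by rw [f0]; rintro rfl; exact ha' hz
  let F : ℕ → ℕ := fun k => if k = l - 1 then z else f k
  have FL : F (l - 1) = z := by simp [F]
  have Fk : ∀ k, k ≠ l - 1 → F k = f k := fun k hk => by simp [F, hk]
  have F0 := Fk 0 (by omega)
  have F1 := Fk 1 (by omega)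
  have F2 := Fk 2 (by omega)
  have Fa := Fk (l - 2) (by omega)
  have Fb := Fk (l - 3) (by omega)
  refine ⟨F, ?_, ?_, ?_, ?_, ?_, ?_, ?_⟩
  · intro k hk
    by_cases h : k = l - 1
    · subst h; rw [FL]; exact hz
    · rw [Fk k h]; exact fm k
  · intro k hk
    rw [Fk k (by omega)]
    by_cases h : k + 1 = l - 1
    · rw [h, FL]
      have : k = l - 2 := by omega
      subst this; exact hz1.symm
    · rw [Fk _ h]; exact (fn1 k).symm
  · rw [FL, F0]; exact hz0
  · intro k hk
    rw [Fk k (by omega), Fk (k + 2) (by omega)]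
    rintro ⟨h, -⟩
    exact fn2 k h.symm
  · rw [FL, F0, Fa, Fb]
    rintro ⟨h1, h2⟩
    exact (hz2 h2).1 h1.symm
  · rw [FL, F0, F1, Fa]
    rintro ⟨h1, h2⟩
    exact (hz2 h1).2 h2
  · rw [F0, F2]
    rintro ⟨-, h⟩
    exact fn2 0 h.symm

/-- The pattern used when all lists are equal. -/
def halPat (l k : ℕ) : ℕ :=
  if l % 3 = 0 then k % 3
  else if l % 3 = 1 then (if k = l - 1 then 1 else k % 3)
  else (if k = l - 1 then 1 else if k < l - 5 then k % 3 else if k = l - 5 then 1 else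
    (k - (l - 4)) % 3)

set_option maxHeartbeats 4000000 in
theorem hal_pat_cyc (l : ℕ) (hl : 8 ≤ l) : HalCyc l (halPat l) := by
  have h3 : l % 3 = 0 ∨ l % 3 = 1 ∨ l % 3 = 2 := by omega
  refine ⟨?_, ?_, ?_, ?_, ?_, ?_⟩ <;> try intro k hk
  all_goals
    unfold halPat
    rcases h3 with h | h | h <;> simp only [h] <;> simp only [if_true, if_false, OfNat.ofNat_ne_zero, one_ne_zero, OfNat.ofNat_ne_one] <;> (try split_ifs) <;> first | omega | simp

theorem hal_pat_lt (l k : ℕ) : halPat l k < 3 := by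
  unfold halPat; split_ifs <;> omega

theorem hal_cycle_list {l : ℕ} [NeZero l] (hl : 8 ≤ l) (L : ZMod l → Finset ℕ)
    (hL : ∀ i, 3 ≤ (L i).card) :
    ∃ e : ZMod l → ℕ, (∀ i, e i ∈ L i) ∧ (∀ i, e i ≠ e (i + 1)) ∧
      ∀ i, ¬ (e i = e (i + 2) ∧ e (i + 1) = e (i + 3)) := by
  choose L' hL1 hL2 using fun i => Finset.exists_subset_card_eq (hL i)
  by_cases hall : ∀ i, L' i = L' (i - 1)
  · have hconst : ∀ n : ℕ, L' (n : ZMod l) = L' 0 := by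
      intro n
      induction n with
      | zero => simp
      | succ n ih => rw [hall]; simpa using ih
    have hc : ∀ i, L' i = L' 0 := fun i => by
      have := hconst i.val
      rwa [ZMod.natCast_zmod_val] at this
    obtain ⟨a, b, c, hab, hac, hbc, habc⟩ := Finset.card_eq_three.1 (hL2 0)
    let s : ℕ → ℕ := fun k => if k = 0 then a else if k = 1 then b else c
    have sinj : ∀ m < 3, ∀ n < 3, s m = s n → m = n := by
      intro m hm n hn h
      simp only [s] at h
      split_ifs at h <;> omega
    have key := hal_cyc_transfer hl (halPat l) (hal_pat_cyc l hl)
    refine ⟨fun i => s (halPat l i.val), ?_, ?_, ?_⟩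
    · intro i
      apply hL1
      rw [hc, habc]
      simp only [s]
      split_ifs <;> simp
    · intro i h
      exact (key i).1 (sinj _ (hal_pat_lt _ _) _ (hal_pat_lt _ _) h)
    · rintro i ⟨h1, h2⟩
      exact (key i).2 ⟨sinj _ (hal_pat_lt _ _) _ (hal_pat_lt _ _) h1,
        sinj _ (hal_pat_lt _ _) _ (hal_pat_lt _ _) h2⟩
  · push Not at hall
    obtain ⟨i0, hi0⟩ := hall
    have : ∃ a ∈ L' i0, a ∉ L' (i0 - 1) := by
      by_contra! h
      exact hi0 (Finset.eq_of_subset_of_card_le h (by rw [hL2, hL2]))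
    obtain ⟨a, ha, ha'⟩ := this
    obtain ⟨f, hf, hcyc⟩ := hal_cyc_greedy l hl (fun k => L' (i0 + (k : ZMod l)))
      (fun k => (hL2 _).ge) a (by simpa using ha) (by
        have : ((l - 1 : ℕ) : ZMod l) = -1 := by
          rw [Nat.cast_sub (by omega)]; simp
        simp only [this]
        rwa [← sub_eq_add_neg])
    have key := hal_cyc_transfer hl f hcyc
    refine ⟨fun i => f (i - i0).val, ?_, ?_, ?_⟩
    · intro i
      have := hf (i - i0).val (ZMod.val_lt _)
      rw [ZMod.natCast_zmod_val] at this
      apply hL1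
      simpa using this
    · intro i
      have := (key (i - i0)).1
      rwa [show i - i0 + 1 = i + 1 - i0 by ring] at this
    · intro i
      have := (key (i - i0)).2
      rwa [show i - i0 + 1 = i + 1 - i0 by ring, show i - i0 + 2 = i + 2 - i0 by ring,
        show i - i0 + 3 = i + 3 - i0 by ring] at this

/-! ### Selection of special leaves -/

set_option maxHeartbeats 4000000 in
theorem hal_two_inv_aux {X : Type*} [Fintype X] (n : ℕ) : ∀ (f g : X → X),
    (∀ x, f (f x) = x) → (∀ x, g (g x) = x) →
    (Finset.univ.filter (fun x => f x ≠ x)).card ≤ n →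
    ∃ col : X → Bool, (∀ x, f x ≠ x → col (f x) ≠ col x) ∧
      (∀ x, g x ≠ x → col (g x) ≠ col x) := by
  induction n with
  | zero =>
    intro f g hf hg hn
    have hfx : ∀ x, f x = x := by
      intro x
      by_contra h
      have : x ∈ Finset.univ.filter (fun x => f x ≠ x) := by simpa using h
      rw [Finset.card_eq_zero.1 (Nat.le_zero.1 hn)] at this
      simp at this
    let e := Fintype.equivFin X
    refine ⟨fun x => decide (e x < e (g x)), fun x h => absurd (hfx x) h, ?_⟩
    intro x hx
    have hne : e (g x) ≠ e x := fun h => hx (e.injective h)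
    simp only [hg]
    intro h
    rcases lt_or_gt_of_ne hne with h1 | h1
    · have h2 : ¬ (e x < e (g x)) := not_lt.2 h1.le
      simp [h1, h2] at h
    · have h2 : ¬ (e (g x) < e x) := not_lt.2 (le_of_lt h1)
      simp [h1, h2] at h
  | succ n ih =>
    intro f g hf hg hn
    by_cases hfix : ∀ x, f x = x
    · apply ih f g hf hg
      have : (Finset.univ.filter (fun x => f x ≠ x)) = ∅ := by
        ext x; simp [hfix x]
      rw [this]; simp
    push Not at hfix
    obtain ⟨a, ha⟩ := hfix
    obtain ⟨b, hb⟩ : ∃ b, b = f a := ⟨_, rfl⟩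
    have hba : f b = a := by rw [hb, hf]
    have hab : a ≠ b := by rw [hb]; exact ha.symm
    let f' : X → X := fun z => if z = a ∨ z = b then z else f z
    let g' : X → X := fun z => if z = a ∨ z = b then z else
      if z = g a then (if g b = b then z else g b) else
      if z = g b then (if g a = a then z else g a) else g z
    have hf' : ∀ x, f' (f' x) = x := by
      intro x; simp only [f']; grind
    have hg' : ∀ x, g' (g' x) = x := by
      intro x; simp only [g']; grind
    have hcard : (Finset.univ.filter (fun x => f' x ≠ x)).card ≤ n := by
      have : (Finset.univ.filter (fun x => f' x ≠ x)) ⊂ (Finset.univ.filter (fun x => f x ≠ x)) := by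
        refine Finset.ssubset_iff_subset_ne.2 ⟨?_, ?_⟩
        · intro z hz
          simp only [Finset.mem_filter, Finset.mem_univ, true_and, f'] at hz ⊢
          grind
        · intro h
          have : a ∈ (Finset.univ.filter (fun x => f' x ≠ x)) := by
            rw [h]; simpa using ha
          simp [f'] at this
      have := Finset.card_lt_card this
      omega
    obtain ⟨col, hc1, hc2⟩ := ih f' g' hf' hg' hcard
    let ca : Bool := if g a ≠ a ∧ g a ≠ b then !(col (g a)) else
      if g b ≠ b ∧ g b ≠ a then col (g b) else true
    refine ⟨fun z => if z = a then ca else if z = b then !ca else col z, ?_, ?_⟩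
    · intro x hx
      have := hc1 x
      simp only [f'] at this
      grind
    · intro x hx
      have h1 := hc2 x
      have h2 := hc2 (g a)
      have h3 := hc2 (g b)
      have ea := hg a
      have eb := hg b
      have ex := hg x
      simp only [g'] at h1 h2 h3
      simp only [ca]
      clear hf' hg' hc1 hc2 hcard ih hn hf hg hb hba ha
      by_cases k1 : g a = a <;> by_cases k2 : g a = b <;> by_cases k3 : g b = b <;>
        by_cases k4 : x = a <;> by_cases k5 : x = b <;>
        cases k6 : col (g a) <;> cases k7 : col (g b) <;> grind

theorem hal_two_inv {X : Type*} [Fintype X] (f g : X → X)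
    (hf : ∀ x, f (f x) = x) (hg : ∀ x, g (g x) = x) :
    ∃ col : X → Bool, (∀ x, f x ≠ x → col (f x) ≠ col x) ∧
      (∀ x, g x ≠ x → col (g x) ≠ col x) :=
  hal_two_inv_aux _ f g hf hg le_rfl

theorem hal_pairing {X : Type*} (n : ℕ) : ∀ s : Finset X, s.card ≤ n →
    ∃ g : X → X, (∀ x, g (g x) = x) ∧ (∀ x, x ∉ s → g x = x) ∧ (∀ x ∈ s, g x ∈ s) ∧
      ∀ x ∈ s, ∀ y ∈ s, g x = x → g y = y → x = y := by
  induction n using Nat.strong_induction_on with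
  | _ n ih =>
    intro s hs
    by_cases h : s.card ≤ 1
    · refine ⟨id, fun _ => rfl, fun _ _ => rfl, fun _ h => h, fun x hx y hy _ _ => ?_⟩
      exact Finset.card_le_one.1 h x hx y hy
    · obtain ⟨a, ha, b, hb, hab⟩ := Finset.one_lt_card.1 (not_le.1 h)
      have hc : ((s.erase a).erase b).card = s.card - 2 := by
        rw [Finset.card_erase_of_mem (by simp [hb, hab.symm]), Finset.card_erase_of_mem ha]
        omega
      obtain ⟨g, g1, g2, g3, g4⟩ := ih (n - 2) (by omega) ((s.erase a).erase b) (by omega)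
      refine ⟨fun x => if x = a then b else if x = b then a else g x, ?_, ?_, ?_, ?_⟩
      · intro x
        have ea := g2 a (by simp)
        have eb := g2 b (by simp)
        have := g1 x
        grind
      · intro x hx
        have := g2 x (by simp [hx])
        grind
      · intro x hx
        have := g3 x
        simp only [Finset.mem_erase] at this
        grind
      · intro x hx y hy
        have := g4 x
        simp only [Finset.mem_erase] at this
        grind

theorem hal_halving {X K : Type*} [Fintype X] (f : X → X) (hf : ∀ x, f (f x) = x) (cls : X → K)
    (Y : Finset X) (x0 : X) :
    ∃ S ⊆ Y, x0 ∉ S ∧ (∀ x ∈ S, f x ≠ x → f x ∉ S) ∧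
      ∀ k, (Y.filter (fun x => cls x = k)).card ≤ 2 * (S.filter (fun x => cls x = k)).card + 1 := by
  choose g g1 g2 g3 g4 using fun k : K =>
    hal_pairing _ (Y.filter (fun x => cls x = k)) le_rfl
  have hcls : ∀ k x, cls (g k x) = k ↔ cls x = k := by
    have aux : ∀ k x, cls x = k → cls (g k x) = k := by
      intro k x hx
      by_cases h : x ∈ Y.filter (fun x => cls x = k)
      · exact (Finset.mem_filter.1 (g3 k x h)).2
      · rw [g2 k x h]; exact hx
    intro k x
    refine ⟨fun h => ?_, aux k x⟩
    have := aux k _ h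
    rwa [g1] at this
  obtain ⟨col, hc1, hc2⟩ := hal_two_inv f (fun x => g (cls x) x) hf (by
    intro x
    have := (hcls (cls x) x).2 rfl
    simp only [this, g1])
  refine ⟨Y.filter (fun x => col x = !(col x0)), Finset.filter_subset _ _, ?_, ?_, ?_⟩
  · simp
  · intro x hx hfx hx'
    simp only [Finset.mem_filter] at hx hx'
    exact hc1 x hfx (by rw [hx.2, hx'.2])
  · intro k
    set s := Y.filter (fun x => cls x = k) with hs
    have e1 : ((Y.filter (fun x => col x = !(col x0))).filter (fun x => cls x = k))
        = s.filter (fun x => col x = !(col x0)) := by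
      rw [hs, Finset.filter_filter, Finset.filter_filter]
      congr 1; ext x; simp [and_comm]
    rw [e1]
    have e2 := Finset.card_filter_add_card_filter_not (s := s) (fun x => col x = !(col x0))
    have e3 := Finset.card_filter_add_card_filter_not
      (s := s.filter (fun x => ¬ col x = !(col x0))) (fun x => g k x = x)
    have e4 : ((s.filter (fun x => ¬ col x = !(col x0))).filter (fun x => g k x = x)).card ≤ 1 := by
      rw [Finset.card_le_one]
      intro x hx y hy
      simp only [Finset.mem_filter] at hx hy
      exact g4 k x hx.1.1 y hy.1.1 hx.2 hy.2
    have e5 : ((s.filter (fun x => ¬ col x = !(col x0))).filter (fun x => ¬ g k x = x)).card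
        ≤ (s.filter (fun x => col x = !(col x0))).card := by
      apply Finset.card_le_card_of_injOn (g k)
      · intro x hx
        simp only [Finset.coe_filter, Finset.mem_filter, Set.mem_setOf_eq] at hx ⊢
        have hk : cls x = k := by
          have := hx.1.1
          rw [hs, Finset.mem_filter] at this
          exact this.2
        refine ⟨g3 k x hx.1.1, ?_⟩
        have := hc2 x
        simp only [hk] at this
        have h1 := this hx.2
        have h2 := hx.1.2
        revert h1 h2
        cases col (g k x) <;> cases col x <;> cases col x0 <;> simp
      · intro x _ y _ hxy
        have := congrArg (g k) hxy
        rwa [g1, g1] at this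
    omega

theorem hal_select {K : Type*} {l : ℕ} [NeZero l] (hl : 4 ≤ l) (cls : ZMod l → K) :
    ∃ I : Finset (ZMod l), (∀ i ∈ I, i + 1 ∉ I) ∧
      ∀ k, (Finset.univ.filter (fun i => cls i = k)).card ≤
        4 * (I.filter (fun i => cls i = k)).card + 3 := by
  let φ : ℕ → ℕ := fun k => if k % 2 = 0 then (if k + 1 < l then k + 1 else k) else k - 1
  have hφl : ∀ k < l, φ k < l := by intro k hk; simp only [φ]; split_ifs <;> omega
  have hφ : ∀ k < l, φ (φ k) = k := by intro k hk; simp only [φ]; split_ifs <;> omega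
  let f : ZMod l → ZMod l := fun i => ((φ i.val : ℕ) : ZMod l)
  have hval : ∀ k < l, ((k : ℕ) : ZMod l).val = k := fun k hk => by
    rw [ZMod.val_natCast, Nat.mod_eq_of_lt hk]
  have hf : ∀ i, f (f i) = i := by
    intro i
    simp only [f]
    rw [hval _ (hφl _ (ZMod.val_lt i)), hφ _ (ZMod.val_lt i), ZMod.natCast_zmod_val]
  have hv1 := fun i : ZMod l => hal_val_add i 1 (by omega)
  have hne1 : ∀ i : ZMod l, i + 1 ≠ i := by
    intro i h
    have h2 := hv1 i
    push_cast at h2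
    rw [h] at h2
    have := ZMod.val_lt i
    split_ifs at h2 <;> omega
  obtain ⟨I0, -, hx0, hI0, hc0⟩ := hal_halving f hf cls Finset.univ ((l - 1 : ℕ) : ZMod l)
  have hpair : ∀ i ∈ I0, i.val % 2 = 0 → i.val + 1 < l → i + 1 ∉ I0 := by
    intro i hi h1 h2
    have : f i = i + 1 := by
      simp only [f, φ, if_pos h1, if_pos h2]
      push_cast
      rw [ZMod.natCast_zmod_val]
    rw [← this]
    exact hI0 i hi (by rw [this]; exact hne1 i)
  have hlast : ∀ i ∈ I0, i.val + 1 ≠ l := by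
    intro i hi h
    apply hx0
    have : ((l - 1 : ℕ) : ZMod l) = i := by
      apply ZMod.val_injective
      rw [hval _ (by omega)]; omega
    rwa [this]
  have h3 : ∀ i ∈ I0, i + 1 ∈ I0 → i + 1 + 1 ∉ I0 := by
    intro i hi hi1
    have h2 := hv1 i
    push_cast at h2
    have := ZMod.val_lt i
    have a1 := hlast i hi
    have a2 := hlast _ hi1
    rw [if_pos (by omega)] at h2
    by_cases hp : i.val % 2 = 0
    · exact absurd hi1 (hpair i hi hp (by omega))
    · have := ZMod.val_lt (i + 1)
      exact hpair _ hi1 (by omega) (by omega)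
  let f' : ZMod l → ZMod l := fun i => if i ∈ I0 ∧ i + 1 ∈ I0 then i + 1 else
    if i ∈ I0 ∧ i - 1 ∈ I0 then i - 1 else i
  have hf' : ∀ i, f' (f' i) = i := by
    intro i
    by_cases c1 : i ∈ I0 ∧ i + 1 ∈ I0
    · have e : f' i = i + 1 := by simp [f', c1]
      rw [e]
      simp only [f']
      rw [if_neg (fun h => h3 i c1.1 c1.2 h.2), add_sub_cancel_right, if_pos ⟨c1.2, c1.1⟩]
    · by_cases c2 : i ∈ I0 ∧ i - 1 ∈ I0
      · have e : f' i = i - 1 := by simp only [f']; rw [if_neg c1, if_pos c2]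
        rw [e]
        simp only [f']
        rw [sub_add_cancel, if_pos ⟨c2.2, c2.1⟩]
      · have e : f' i = i := by simp only [f']; rw [if_neg c1, if_neg c2]
        rw [e, e]
  obtain ⟨I, hII, -, hI, hc⟩ := hal_halving f' hf' cls I0 0
  refine ⟨I, ?_, ?_⟩
  · intro i hi hi1
    have e : f' i = i + 1 := by simp [f', hII hi, hII hi1]
    exact hI i hi (by rw [e]; exact hne1 i) (by rwa [e])
  · intro k
    have := hc0 k
    have := hc k
    omega

/-! ### Almost regular tournaments -/

theorem hal_order {V : Type*} (s O : Finset V) (p : V) (hp : p ∈ s) (hO : O ⊆ s) (hpO : p ∉ O) :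
    ∃ ι : V → ℕ, (∀ u ∈ s, ∀ v ∈ s, ι u = ι v → u = v) ∧ (∀ u ∈ s, ι u < s.card) ∧ ι p = 0 ∧
      ∀ v ∈ O, 1 ≤ ι v ∧ ι v ≤ O.card := by
  let l : List V := p :: (O.toList ++ ((s.erase p) \ O).toList)
  have hmem : ∀ u, u ∈ s → u ∈ l := by
    intro u hu
    simp only [l, List.mem_cons, List.mem_append, Finset.mem_toList, Finset.mem_sdiff,
      Finset.mem_erase]
    tauto
  have hlen : l.length = s.card := by
    have h1 : O ⊆ s.erase p := fun x hx =>
      Finset.mem_erase.2 ⟨fun h => hpO (h ▸ hx), hO hx⟩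
    simp only [l, List.length_cons, List.length_append, Finset.length_toList]
    rw [Finset.card_sdiff_of_subset h1, Finset.card_erase_of_mem hp]
    have := Finset.card_le_card h1
    rw [Finset.card_erase_of_mem hp] at this
    have := Finset.card_pos.2 ⟨p, hp⟩
    omega
  refine ⟨fun u => l.idxOf u, ?_, ?_, ?_, ?_⟩
  · intro u hu v hv h
    exact (List.idxOf_inj (hmem u hu)).1 h
  · intro u hu
    rw [← hlen]
    exact List.idxOf_lt_length_of_mem (hmem u hu)
  · simp [l]
  · intro v hv
    have hvp : p ≠ v := fun h => hpO (h ▸ hv)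
    have e : l.idxOf v = O.toList.idxOf v + 1 := by
      simp only [l]
      rw [List.idxOf_cons_ne _ hvp, List.idxOf_append_of_mem (Finset.mem_toList.2 hv)]
    have := List.idxOf_lt_length_of_mem (Finset.mem_toList.2 hv)
    rw [Finset.length_toList] at this
    simp only [e]
    omega

theorem hal_tour {V : Type*} (s O : Finset V) (p : V) (D : ℕ) (hs : s.card ≤ 2 * D + 1)
    (hp : p ∈ s) (hO : O ⊆ s) (hpO : p ∉ O) (hOc : O.card ≤ D) :
    ∃ R : V → V → Prop, (∀ u ∈ s, ∀ v ∈ s, u ≠ v → R u v ∨ R v u) ∧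
      (∀ v ∈ s, (s.filter (fun u => R u v)).card ≤ D) ∧
      (∀ v ∈ s, (s.filter (fun u => u ≠ v ∧ ¬ R u v)).card ≤ D) ∧
      ∀ v ∈ O, R p v := by
  obtain ⟨ι, h1, h2, h3, h4⟩ := hal_order s O p hp hO hpO
  refine ⟨fun u v => (ι u < ι v ∧ ι v ≤ ι u + D) ∨ (ι v < ι u ∧ ι v + D + 1 ≤ ι u), ?_, ?_, ?_, ?_⟩
  · intro u hu v hv huv
    have : ι u ≠ ι v := fun h => huv (h1 u hu v hv h)
    omega
  · intro v hv
    have hvl := h2 v hv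
    have : (s.filter (fun u => (ι u < ι v ∧ ι v ≤ ι u + D) ∨ (ι v < ι u ∧ ι v + D + 1 ≤ ι u))).card
        ≤ (Finset.Icc 1 D).card := by
      apply Finset.card_le_card_of_injOn
        (fun u => if ι u < ι v then ι v - ι u else ι v + (2 * D + 1) - ι u)
      · intro u hu
        have hu := Finset.mem_filter.1 (Finset.mem_coe.1 hu)
        have := h2 u hu.1
        simp only [Finset.coe_Icc, Set.mem_Icc]
        split_ifs <;> omega
      · intro u hu w hw h
        have hu := Finset.mem_filter.1 (Finset.mem_coe.1 hu)
        have hw := Finset.mem_filter.1 (Finset.mem_coe.1 hw)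
        have := h2 u hu.1
        have := h2 w hw.1
        apply h1 u hu.1 w hw.1
        simp only at h
        split_ifs at h <;> omega
    simpa using this
  · intro v hv
    have hvl := h2 v hv
    have : (s.filter (fun u => u ≠ v ∧ ¬ ((ι u < ι v ∧ ι v ≤ ι u + D) ∨
        (ι v < ι u ∧ ι v + D + 1 ≤ ι u)))).card ≤ (Finset.Icc 1 D).card := by
      apply Finset.card_le_card_of_injOn
        (fun u => if ι v < ι u then ι u - ι v else ι u + (2 * D + 1) - ι v)
      · intro u hu
        have hu := Finset.mem_filter.1 (Finset.mem_coe.1 hu)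
        have := h2 u hu.1
        have hne : ι u ≠ ι v := fun h => hu.2.1 (h1 u hu.1 v hv h)
        simp only [Finset.coe_Icc, Set.mem_Icc]
        split_ifs <;> omega
      · intro u hu w hw h
        have hu := Finset.mem_filter.1 (Finset.mem_coe.1 hu)
        have hw := Finset.mem_filter.1 (Finset.mem_coe.1 hw)
        have := h2 u hu.1
        have := h2 w hw.1
        have hne : ι u ≠ ι v := fun h => hu.2.1 (h1 u hu.1 v hv h)
        have hne' : ι w ≠ ι v := fun h => hw.2.1 (h1 w hw.1 v hv h)
        apply h1 u hu.1 w hw.1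
        simp only at h
        split_ifs at h <;> omega
    simpa using this
  · intro v hv
    have := h4 v hv
    left
    omega

/-! ### Counting bad colours -/

theorem hal_card_erase (A : Finset ℕ) (a : ℕ) : A.card ≤ (A.erase a).card + 1 := by
  have := Finset.pred_card_le_card_erase (s := A) (a := a)
  omega

theorem hal_erase_union_ge (A B : Finset ℕ) (a : ℕ) : (A ∪ B).card ≤ (A.erase a ∪ B).card + 1 := by
  have : A ∪ B ⊆ insert a (A.erase a ∪ B) := by
    intro x hx
    simp only [Finset.mem_insert, Finset.mem_union, Finset.mem_erase] at *
    tauto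
  exact (Finset.card_le_card this).trans (Finset.card_insert_le _ _)

theorem hal_erase_union_eq (A B : Finset ℕ) (a : ℕ) (ha : a ∉ A \ B) :
    A.erase a ∪ B = A ∪ B := by
  ext x
  simp only [Finset.mem_union, Finset.mem_erase, Finset.mem_sdiff] at *
  by_cases hx : x = a
  · subst hx; tauto
  · tauto

theorem hal_sdiff_card (A B : Finset ℕ) : (A \ B).card + B.card = (A ∪ B).card :=
  Finset.card_sdiff_add_card A B

/-- one pair of sets -/
theorem hal_bad_pair (A B : Finset ℕ) (m : ℕ) (h1 : m ≤ (A ∪ B).card) (h2 : m ≤ B.card + 1) :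
    ∃ Bad : Finset ℕ, Bad.card ≤ 1 ∧ ∀ a ∉ Bad, m ≤ (A.erase a ∪ B).card := by
  by_cases h : m < (A ∪ B).card
  · refine ⟨∅, by simp, fun a _ => ?_⟩
    have := hal_erase_union_ge A B a
    omega
  · refine ⟨A \ B, ?_, fun a ha => ?_⟩
    · have := hal_sdiff_card A B
      omega
    · rw [hal_erase_union_eq A B a ha]; exact h1

/-- one hit among three sets -/
theorem hal_bad_triple (A B C : Finset ℕ) (N : ℕ) (hA : N ≤ A.card + 1) (hB : N ≤ B.card + 2)
    (hC : N ≤ C.card + 2) (hAB : N ≤ (A ∪ B).card + 1) (hAC : N ≤ (A ∪ C).card + 1)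
    (hBC : N ≤ (B ∪ C).card + 1) (hABC : N ≤ (A ∪ (B ∪ C)).card) :
    ∃ Bad : Finset ℕ, Bad.card ≤ 1 ∧ ∀ a ∉ Bad, N ≤ (A.erase a ∪ B).card + 1 ∧
      N ≤ (A.erase a ∪ C).card + 1 ∧ N ≤ (A.erase a ∪ (B ∪ C)).card := by
  have sAB := hal_sdiff_card A B
  have sAC := hal_sdiff_card A C
  have sABC := hal_sdiff_card A (B ∪ C)
  have gAB := hal_erase_union_ge A B
  have gAC := hal_erase_union_ge A C
  have gABC := hal_erase_union_ge A (B ∪ C)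
  by_cases t1 : N = (A ∪ B).card + 1
  · have hAe : A = A ∪ B := Finset.eq_of_subset_of_card_le Finset.subset_union_left (by omega)
    have t2 : N ≤ (A ∪ C).card := by
      by_contra hh
      have hAe' : A = A ∪ C := Finset.eq_of_subset_of_card_le Finset.subset_union_left (by omega)
      have : A ∪ (B ∪ C) = A := by rw [← Finset.union_assoc, ← hAe, ← hAe']
      rw [this] at hABC
      rw [← hAe] at t1
      omega
    refine ⟨A \ B, by omega, fun a ha => ⟨?_, ?_, ?_⟩⟩
    · rw [hal_erase_union_eq _ _ _ ha]; omega
    · have := gAC a; omega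
    · rw [hal_erase_union_eq _ _ _ (fun h => ha ?_)]
      · exact hABC
      · simp only [Finset.mem_sdiff, Finset.mem_union] at h ⊢
        tauto
  · by_cases t2 : N = (A ∪ C).card + 1
    · refine ⟨A \ C, by omega, fun a ha => ⟨?_, ?_, ?_⟩⟩
      · have := gAB a; omega
      · rw [hal_erase_union_eq _ _ _ ha]; omega
      · rw [hal_erase_union_eq _ _ _ (fun h => ha ?_)]
        · exact hABC
        · simp only [Finset.mem_sdiff, Finset.mem_union] at h ⊢
          tauto
    · obtain ⟨Bad, hb1, hb2⟩ := hal_bad_pair A (B ∪ C) N hABC (by omega)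
      refine ⟨Bad, hb1, fun a ha => ⟨?_, ?_, hb2 a ha⟩⟩
      · have := gAB a; omega
      · have := gAC a; omega

/-- two hits among three sets, third not shared -/
theorem hal_bad_double (A B C : Finset ℕ) (N : ℕ) (hC : N ≤ C.card + 2)
    (hAC : N ≤ (A ∪ C).card + 1)
    (hBC : N ≤ (B ∪ C).card + 1) (hABC : N ≤ ((A ∪ B) ∪ C).card) :
    ∃ Bad : Finset ℕ, Bad.card ≤ 2 ∧ ∀ a ∉ Bad, N ≤ (A.erase a ∪ C).card + 1 ∧
      N ≤ (B.erase a ∪ C).card + 1 ∧ N ≤ ((A.erase a ∪ B.erase a) ∪ C).card := by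
  have hee : ∀ a, A.erase a ∪ B.erase a = (A ∪ B).erase a := by
    intro a; ext x; simp only [Finset.mem_union, Finset.mem_erase]; tauto
  by_cases t : N = ((A ∪ B) ∪ C).card
  · have s := hal_sdiff_card (A ∪ B) C
    refine ⟨(A ∪ B) \ C, by omega, fun a ha => ⟨?_, ?_, ?_⟩⟩
    · rw [hal_erase_union_eq _ _ _ (fun h => ha ?_)]
      · exact hAC
      · simp only [Finset.mem_sdiff, Finset.mem_union] at h ⊢
        tauto
    · rw [hal_erase_union_eq _ _ _ (fun h => ha ?_)]
      · exact hBC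
      · simp only [Finset.mem_sdiff, Finset.mem_union] at h ⊢
        tauto
    · rw [hee, hal_erase_union_eq _ _ _ ha]; exact hABC
  · obtain ⟨B1, hb1, hb2⟩ := hal_bad_pair A C (N - 1) (by omega) (by omega)
    obtain ⟨B2, hc1, hc2⟩ := hal_bad_pair B C (N - 1) (by omega) (by omega)
    refine ⟨B1 ∪ B2, (Finset.card_union_le _ _).trans (by omega), fun a ha => ?_⟩
    rw [Finset.mem_union, not_or] at ha
    have k1 := hb2 a ha.1
    have k2 := hc2 a ha.2
    have k3 := hal_erase_union_ge (A ∪ B) C a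
    rw [hee]
    refine ⟨by omega, by omega, by omega⟩

/-- The invariant of one class. -/
def HalInv {V : Type*} (N : ℕ) (Sp : Finset V) (G : V → Finset ℕ) (sh : V → V → Prop) : Prop :=
  (∀ z ∈ Sp, ∀ w ∈ Sp, z ≠ w → N ≤ (G z ∪ G w).card + 1 ∧ (sh z w → N ≤ (G z ∪ G w).card)) ∧
  (Sp.card = 3 → N ≤ (Sp.biUnion G).card)

theorem hal_inv_pair {V : Type*} (N : ℕ) (z w : V) (hzw : z ≠ w) (G : V → Finset ℕ)
    (sh : V → V → Prop) (hsym : ∀ a b, sh a b → sh b a)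
    (h : N ≤ (G z ∪ G w).card + 1 ∧ (sh z w → N ≤ (G z ∪ G w).card)) :
    HalInv N {z, w} G sh := by
  refine ⟨?_, ?_⟩
  · intro a ha b hb hab
    simp only [Finset.mem_insert, Finset.mem_singleton] at ha hb
    rcases ha with rfl | rfl <;> rcases hb with rfl | rfl
    · exact absurd rfl hab
    · exact h
    · rw [Finset.union_comm]; exact ⟨h.1, fun hh => h.2 (hsym _ _ hh)⟩
    · exact absurd rfl hab
  · intro hc
    rw [Finset.card_pair hzw] at hc
    omega

theorem hal_inv_triple {V : Type*} (N : ℕ) (z w u : V) (G : V → Finset ℕ)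
    (sh : V → V → Prop) (hsym : ∀ a b, sh a b → sh b a)
    (h : N ≤ (G z ∪ G w).card + 1 ∧ (sh z w → N ≤ (G z ∪ G w).card))
    (h' : N ≤ (G z ∪ G u).card + 1 ∧ (sh z u → N ≤ (G z ∪ G u).card))
    (h'' : N ≤ (G w ∪ G u).card + 1 ∧ (sh w u → N ≤ (G w ∪ G u).card))
    (h3 : N ≤ (G z ∪ (G w ∪ G u)).card) :
    HalInv N {z, w, u} G sh := by
  refine ⟨?_, ?_⟩
  · intro a ha b hb hab
    simp only [Finset.mem_insert, Finset.mem_singleton] at ha hb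
    rcases ha with rfl | rfl | rfl <;> rcases hb with rfl | rfl | rfl
    · exact absurd rfl hab
    · exact h
    · exact h'
    · rw [Finset.union_comm]; exact ⟨h.1, fun hh => h.2 (hsym _ _ hh)⟩
    · exact absurd rfl hab
    · exact h''
    · rw [Finset.union_comm]; exact ⟨h'.1, fun hh => h'.2 (hsym _ _ hh)⟩
    · rw [Finset.union_comm]; exact ⟨h''.1, fun hh => h''.2 (hsym _ _ hh)⟩
    · exact absurd rfl hab
  · intro _
    simpa [Finset.biUnion_insert] using h3

theorem hal_abs_bad {V : Type*} (N : ℕ) (Sp T : Finset V) (G : V → Finset ℕ)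
    (sh sh' : V → V → Prop) (r : V → ℕ) (hSp : Sp.card ≤ 3) (hT : T ⊆ Sp) (hT2 : T.card ≤ 2)
    (hI : HalInv N Sp G sh)
    (hr : ∀ z ∈ Sp, N + r z + (if z ∈ T then 1 else 0) ≤ (G z).card + 2)
    (hs1 : ∀ z w, sh' z w → sh z w) (hsr : ∀ z w, sh' z w → 1 ≤ r z ∧ 1 ≤ r w)
    (hsym : ∀ z w, sh' z w → sh' w z)
    (hTT : ∀ z ∈ T, ∀ w ∈ T, z ≠ w → sh z w ∧ ¬ sh' z w)
    (hu : ∀ z ∈ T, ∀ w ∈ Sp, ∀ w' ∈ Sp, sh' z w → sh' z w' → w = w') :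
    ∃ Bad : Finset ℕ, Bad.card ≤ T.card ∧ ∀ a ∉ Bad,
      HalInv N Sp (fun z => if z ∈ T then (G z).erase a else G z) sh' := by
  obtain ⟨hI1, hI2⟩ := hI
  have hTc : T.card = 0 ∨ T.card = 1 ∨ T.card = 2 := by omega
  rcases hTc with hTc | hTc | hTc
  · rw [Finset.card_eq_zero] at hTc
    subst hTc
    refine ⟨∅, by simp, fun a _ => ?_⟩
    simp only [Finset.notMem_empty, if_false]
    exact ⟨fun z hz w hw hzw => ⟨(hI1 z hz w hw hzw).1, fun h => (hI1 z hz w hw hzw).2 (hs1 _ _ h)⟩,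
      hI2⟩
  · obtain ⟨z, rfl⟩ := Finset.card_eq_one.1 hTc
    have hz : z ∈ Sp := hT (by simp)
    have hrz := hr z hz
    rw [if_pos (by simp)] at hrz
    have hec := Finset.card_erase_of_mem hz
    have hpos := Finset.card_pos.2 ⟨z, hz⟩
    have hc : (Sp.erase z).card = 0 ∨ (Sp.erase z).card = 1 ∨ (Sp.erase z).card = 2 := by omega
    rcases hc with hc | hc | hc
    · refine ⟨∅, by simp, fun a _ => ⟨fun b hb d hd hbd => ?_, fun h => by omega⟩⟩
      exfalso
      exact hbd (Finset.card_le_one.1 (by omega) b hb d hd)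
    · obtain ⟨w, hw⟩ := Finset.card_eq_one.1 hc
      have hSpe : Sp = {z, w} := by rw [← Finset.insert_erase hz, hw]
      have hwz : w ≠ z := by
        have : w ∈ Sp.erase z := by rw [hw]; simp
        exact (Finset.mem_erase.1 this).1
      subst hSpe
      have hrw := hr w (by simp)
      rw [if_neg (by simpa using hwz)] at hrw
      have hp := hI1 z (by simp) w (by simp) hwz.symm
      have : ∃ Bad : Finset ℕ, Bad.card ≤ 1 ∧ ∀ a ∉ Bad, N ≤ ((G z).erase a ∪ G w).card + 1 ∧
          (sh' z w → N ≤ ((G z).erase a ∪ G w).card) := by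
        by_cases hsh : sh' z w
        · have := hsr _ _ hsh
          obtain ⟨Bad, hb1, hb2⟩ := hal_bad_pair (G z) (G w) N (hp.2 (hs1 _ _ hsh)) (by omega)
          exact ⟨Bad, hb1, fun a ha => ⟨(hb2 a ha).trans (by omega), fun _ => hb2 a ha⟩⟩
        · obtain ⟨Bad, hb1, hb2⟩ := hal_bad_pair (G z) (G w) (N - 1) (by omega) (by omega)
          exact ⟨Bad, hb1, fun a ha => ⟨by have := hb2 a ha; omega, fun h => absurd h hsh⟩⟩
      obtain ⟨Bad, hb1, hb2⟩ := this
      refine ⟨Bad, by simpa using hb1, fun a ha => ?_⟩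
      apply hal_inv_pair N z w hwz.symm _ _ hsym
      simpa [hwz] using hb2 a ha
    · obtain ⟨w, u, hwu, hw⟩ := Finset.card_eq_two.1 hc
      have hSpe : Sp = {z, w, u} := by rw [← Finset.insert_erase hz, hw]
      have hwz : w ≠ z := by
        have : w ∈ Sp.erase z := by rw [hw]; simp
        exact (Finset.mem_erase.1 this).1
      have huz : u ≠ z := by
        have : u ∈ Sp.erase z := by rw [hw]; simp
        exact (Finset.mem_erase.1 this).1
      have hI2' := hI2 (by omega)
      subst hSpe
      have hrw := hr w (by simp)
      rw [if_neg (by simpa using hwz)] at hrw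
      have hru := hr u (by simp)
      rw [if_neg (by simpa using huz)] at hru
      have p1 := hI1 z (by simp) w (by simp) hwz.symm
      have p2 := hI1 z (by simp) u (by simp) huz.symm
      have p3 := hI1 w (by simp) u (by simp) hwu
      have p4 : N ≤ (G z ∪ (G w ∪ G u)).card := by
        simpa [Finset.biUnion_insert] using hI2'
      suffices hsuf : ∃ Bad : Finset ℕ, Bad.card ≤ 1 ∧ ∀ a ∉ Bad,
          (N ≤ ((G z).erase a ∪ G w).card + 1 ∧ (sh' z w → N ≤ ((G z).erase a ∪ G w).card)) ∧
          (N ≤ ((G z).erase a ∪ G u).card + 1 ∧ (sh' z u → N ≤ ((G z).erase a ∪ G u).card)) ∧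
          N ≤ ((G z).erase a ∪ (G w ∪ G u)).card by
        obtain ⟨Bad, hb1, hb2⟩ := hsuf
        refine ⟨Bad, by simpa using hb1, fun a ha => ?_⟩
        obtain ⟨k1, k2, k3⟩ := hb2 a ha
        apply hal_inv_triple N z w u _ _ hsym
        · simpa [hwz] using k1
        · simpa [huz] using k2
        · simp only [Finset.mem_singleton, hwz, huz, if_false]
          exact ⟨p3.1, fun h => p3.2 (hs1 _ _ h)⟩
        · simpa [hwz, huz] using k3
      by_cases s1 : sh' z w
      · have s2 : ¬ sh' z u := fun h => hwu (hu z (by simp) w (by simp) u (by simp) s1 h)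
        have := hsr _ _ s1
        obtain ⟨Bad, hb1, hb2⟩ := hal_bad_pair (G z) (G w) N (p1.2 (hs1 _ _ s1)) (by omega)
        refine ⟨Bad, hb1, fun a ha => ⟨⟨by have := hb2 a ha; omega, fun _ => hb2 a ha⟩,
          ⟨?_, fun h => absurd h s2⟩, ?_⟩⟩
        · have k1 : (G z).card ≤ ((G z).erase a).card + 1 := hal_card_erase _ _
          have k2 := Finset.card_le_card (Finset.subset_union_left (s₁ := (G z).erase a) (s₂ := G u))
          omega
        · refine (hb2 a ha).trans (Finset.card_le_card ?_)
          exact Finset.union_subset_union_right Finset.subset_union_left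
      · by_cases s2 : sh' z u
        · have := hsr _ _ s2
          obtain ⟨Bad, hb1, hb2⟩ := hal_bad_pair (G z) (G u) N (p2.2 (hs1 _ _ s2)) (by omega)
          refine ⟨Bad, hb1, fun a ha => ⟨⟨?_, fun h => absurd h s1⟩,
            ⟨by have := hb2 a ha; omega, fun _ => hb2 a ha⟩, ?_⟩⟩
          · have k1 : (G z).card ≤ ((G z).erase a).card + 1 := hal_card_erase _ _
            have k2 := Finset.card_le_card (Finset.subset_union_left (s₁ := (G z).erase a) (s₂ := G w))
            omega
          · refine (hb2 a ha).trans (Finset.card_le_card ?_)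
            exact Finset.union_subset_union_right Finset.subset_union_right
        · obtain ⟨Bad, hb1, hb2⟩ := hal_bad_triple (G z) (G w) (G u) N (by omega) (by omega)
            (by omega) p1.1 p2.1 p3.1 p4
          exact ⟨Bad, hb1, fun a ha => ⟨⟨(hb2 a ha).1, fun h => absurd h s1⟩,
            ⟨(hb2 a ha).2.1, fun h => absurd h s2⟩, (hb2 a ha).2.2⟩⟩
  · obtain ⟨z, w, hzw, rfl⟩ := Finset.card_eq_two.1 hTc
    have hz : z ∈ Sp := hT (by simp)
    have hw : w ∈ Sp := hT (by simp)
    have hrz := hr z hz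
    rw [if_pos (by simp)] at hrz
    have hrw := hr w hw
    rw [if_pos (by simp)] at hrw
    obtain ⟨s0, s0'⟩ := hTT z (by simp) w (by simp) hzw
    have p1 := (hI1 z hz w hw hzw).2 s0
    have hee : ∀ a, (G z).erase a ∪ (G w).erase a = (G z ∪ G w).erase a := by
      intro a; ext x; simp only [Finset.mem_union, Finset.mem_erase]; tauto
    have p1' : ∀ a, N ≤ ((G z).erase a ∪ (G w).erase a).card + 1 := by
      intro a
      rw [hee]
      exact p1.trans (hal_card_erase _ _)
    have hsd := Finset.card_sdiff_add_card_eq_card hT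
    have hc : (Sp \ {z, w}).card = 0 ∨ (Sp \ {z, w}).card = 1 := by omega
    rcases hc with hc | hc
    · have hSpe : Sp = {z, w} := by
        apply Finset.Subset.antisymm _ hT
        exact Finset.sdiff_eq_empty_iff_subset.1 (Finset.card_eq_zero.1 hc)
      subst hSpe
      refine ⟨∅, by simp, fun a _ => ?_⟩
      apply hal_inv_pair N z w hzw _ _ hsym
      simpa [s0'] using p1' a
    · obtain ⟨u, hu'⟩ := Finset.card_eq_one.1 hc
      have humem : u ∈ Sp \ {z, w} := by rw [hu']; simp
      simp only [Finset.mem_sdiff, Finset.mem_insert, Finset.mem_singleton, not_or] at humem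
      obtain ⟨huS, huz, huw⟩ := humem
      have hSpe : Sp = {z, w, u} := by
        have := Finset.sdiff_union_of_subset hT
        rw [hu'] at this
        rw [← this]
        ext x; simp; tauto
      have hI2' := hI2 (by omega)
      have hru := hr u huS
      rw [if_neg (by simp [huz, huw])] at hru
      have p2 := hI1 z hz u huS (Ne.symm huz)
      have p3 := hI1 w hw u huS (Ne.symm huw)
      have p4 : N ≤ ((G z ∪ G w) ∪ G u).card := by
        rw [hSpe] at hI2'
        rw [Finset.union_assoc]
        simpa [Finset.biUnion_insert] using hI2'
      rw [hTc]
      suffices hsuf : ∃ Bad : Finset ℕ, Bad.card ≤ 2 ∧ ∀ a ∉ Bad,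
          (N ≤ ((G z).erase a ∪ G u).card + 1 ∧ (sh' z u → N ≤ ((G z).erase a ∪ G u).card)) ∧
          (N ≤ ((G w).erase a ∪ G u).card + 1 ∧ (sh' w u → N ≤ ((G w).erase a ∪ G u).card)) ∧
          N ≤ (((G z).erase a ∪ (G w).erase a) ∪ G u).card by
        obtain ⟨Bad, hb1, hb2⟩ := hsuf
        refine ⟨Bad, hb1, fun a ha => ?_⟩
        obtain ⟨k1, k2, k3⟩ := hb2 a ha
        rw [hSpe]
        apply hal_inv_triple N z w u _ _ hsym
        · simpa [s0'] using p1' a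
        · simpa [huz, huw] using k1
        · simpa [huz, huw] using k2
        · rw [Finset.union_assoc] at k3
          simpa [huz, huw] using k3
      by_cases s1 : sh' z u
      · have q1 := hsr _ _ s1
        obtain ⟨B1, hb1, hb2⟩ := hal_bad_pair (G z) (G u) N (p2.2 (hs1 _ _ s1)) (by omega)
        obtain ⟨B2, hc1, hc2⟩ : ∃ B2 : Finset ℕ, B2.card ≤ 1 ∧ ∀ a ∉ B2,
            (N ≤ ((G w).erase a ∪ G u).card + 1 ∧ (sh' w u → N ≤ ((G w).erase a ∪ G u).card)) := by
          by_cases s2 : sh' w u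
          · obtain ⟨B2, hc1, hc2⟩ := hal_bad_pair (G w) (G u) N (p3.2 (hs1 _ _ s2)) (by omega)
            exact ⟨B2, hc1, fun a ha => ⟨by have := hc2 a ha; omega, fun _ => hc2 a ha⟩⟩
          · obtain ⟨B2, hc1, hc2⟩ := hal_bad_pair (G w) (G u) (N - 1) (by omega) (by omega)
            exact ⟨B2, hc1, fun a ha => ⟨by have := hc2 a ha; omega, fun h => absurd h s2⟩⟩
        refine ⟨B1 ∪ B2, (Finset.card_union_le _ _).trans (by omega), fun a ha => ?_⟩
        rw [Finset.mem_union, not_or] at ha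
        have k := hb2 a ha.1
        refine ⟨⟨by omega, fun _ => k⟩, hc2 a ha.2, k.trans (Finset.card_le_card ?_)⟩
        exact Finset.union_subset_union_left Finset.subset_union_left
      · by_cases s2 : sh' w u
        · have q1 := hsr _ _ s2
          obtain ⟨B1, hb1, hb2⟩ := hal_bad_pair (G w) (G u) N (p3.2 (hs1 _ _ s2)) (by omega)
          obtain ⟨B2, hc1, hc2⟩ := hal_bad_pair (G z) (G u) (N - 1) (by omega) (by omega)
          refine ⟨B1 ∪ B2, (Finset.card_union_le _ _).trans (by omega), fun a ha => ?_⟩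
          rw [Finset.mem_union, not_or] at ha
          have k := hb2 a ha.1
          have k' := hc2 a ha.2
          refine ⟨⟨by omega, fun h => absurd h s1⟩, ⟨by omega, fun _ => k⟩,
            k.trans (Finset.card_le_card ?_)⟩
          exact Finset.union_subset_union_left Finset.subset_union_right
        · obtain ⟨Bad, hb1, hb2⟩ := hal_bad_double (G z) (G w) (G u) N (by omega) p2.1 p3.1 p4
          exact ⟨Bad, hb1, fun a ha => ⟨⟨(hb2 a ha).1, fun h => absurd h s1⟩,
            ⟨(hb2 a ha).2.1, fun h => absurd h s2⟩, (hb2 a ha).2.2⟩⟩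

/-! ### Colouring one class -/

theorem hal_hall {V : Type*} (N : ℕ) (Sp : Finset V) (G : V → Finset ℕ) (sh : V → V → Prop)
    (X : Finset ℕ) (hSp : Sp.card ≤ 3) (hI : HalInv N Sp G sh)
    (hG : ∀ z ∈ Sp, N ≤ (G z).card + 2) (hX : X.card + 3 ≤ N) :
    ∃ a : V → ℕ, (∀ z ∈ Sp, a z ∈ G z ∧ a z ∉ X) ∧ ∀ z ∈ Sp, ∀ w ∈ Sp, a z = a w → z = w := by
  have hall : ∀ s : Finset {z // z ∈ Sp}, s.card ≤ (s.biUnion (fun z => G z.1 \ X)).card := by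
    intro s
    have key : N + s.card ≤ (s.biUnion (fun z => G z.1)).card + 3 ∨ s.card = 0 := by
      have hs : s.card ≤ 3 := by
        have := Finset.card_le_univ s
        simp only [Fintype.card_coe] at this
        omega
      have hsc : s.card = 0 ∨ s.card = 1 ∨ s.card = 2 ∨ s.card = 3 := by omega
      rcases hsc with h | h | h | h
      · right; exact h
      · left
        obtain ⟨z, rfl⟩ := Finset.card_eq_one.1 h
        have := hG z.1 z.2
        simp only [Finset.singleton_biUnion, Finset.card_singleton]
        omega
      · left
        obtain ⟨z, w, hzw, rfl⟩ := Finset.card_eq_two.1 h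
        have := (hI.1 z.1 z.2 w.1 w.2 (fun h => hzw (Subtype.ext h))).1
        simp only [Finset.biUnion_insert, Finset.singleton_biUnion, h]
        omega
      · left
        have hc : Sp.card = 3 := by
          have := Finset.card_le_univ s
          simp only [Fintype.card_coe] at this
          omega
        have hsu : s = Finset.univ := by
          rw [← Finset.card_eq_iff_eq_univ, Fintype.card_coe]; omega
        have h3 := hI.2 hc
        have : s.biUnion (fun z => G z.1) = Sp.biUnion G := by
          rw [hsu]; ext x; simp
        rw [this]; omega
    rcases key with h | h
    · have e : s.biUnion (fun z => G z.1 \ X) = (s.biUnion (fun z => G z.1)) \ X := by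
        ext x; simp only [Finset.mem_biUnion, Finset.mem_sdiff]; tauto
      rw [e]
      have := Finset.le_card_sdiff X (s.biUnion (fun z => G z.1))
      omega
    · omega
  obtain ⟨f, hf1, hf2⟩ := (Finset.all_card_le_biUnion_card_iff_exists_injective _).1 hall
  refine ⟨fun z => if h : z ∈ Sp then f ⟨z, h⟩ else 0, ?_, ?_⟩
  · intro z hz
    have := hf2 ⟨z, hz⟩
    simpa [hz] using this
  · intro z hz w hw h
    simp only [hz, hw, dif_pos] at h
    simpa using hf1 h

structure HalSys {V : Type*} (N : ℕ) (cls : V → V) (Nb Sp : V → Finset V)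
    (L : V → Finset ℕ) : Prop where
  symm : ∀ x z, z ∈ Nb x → x ∈ Nb z
  card2 : ∀ x, (Nb x).card ≤ 2
  noC4 : ∀ x x' z z', x ≠ x' → z ≠ z' → z ∈ Nb x → z' ∈ Nb x → z ∈ Nb x' → z' ∈ Nb x' → False
  spc : ∀ y, ∀ z ∈ Sp y, cls z = y
  sp3 : ∀ y, (Sp y).card ≤ 3
  indep : ∀ y y', ∀ z ∈ Sp y, ∀ z' ∈ Sp y', z' ∉ Nb z
  listc : ∀ x, N ≤ (L x).card

noncomputable def halG {V : Type*} (cls : V → V) (Nb : V → Finset V) (L : V → Finset ℕ)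
    (S : Finset V) (c : V → ℕ) (z : V) : Finset ℕ :=
  L z \ ((Nb z).filter (fun x => x ∈ S ∧ cls x ≠ cls z)).image c

def halSh {V : Type*} (cls : V → V) (Nb : V → Finset V) (S : Finset V) (z w : V) : Prop :=
  z ≠ w ∧ ∃ x, x ∉ S ∧ cls x ≠ cls z ∧ cls x ≠ cls w ∧ x ∈ Nb z ∧ x ∈ Nb w

def HalSt {V : Type*} (N : ℕ) (cls : V → V) (Nb Sp : V → Finset V) (L : V → Finset ℕ)
    (S : Finset V) (c : V → ℕ) : Prop :=
  (∀ x ∈ S, c x ∈ L x) ∧ (∀ x ∈ S, ∀ z ∈ S, z ∈ Nb x → cls x ≠ cls z → c x ≠ c z) ∧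
  ∀ y, (∀ z ∈ Sp y, z ∉ S) → HalInv N (Sp y) (halG cls Nb L S c) (halSh cls Nb S)

section
variable {V : Type*} {N : ℕ} {cls : V → V} {Nb Sp : V → Finset V} {L : V → Finset ℕ}

theorem HalSys.start (h : HalSys N cls Nb Sp L) (c : V → ℕ) : HalSt N cls Nb Sp L ∅ c := by
  have hG : ∀ z, halG cls Nb L ∅ c z = L z := by
    intro z; simp [halG]
  refine ⟨by simp, by simp, fun y _ => ⟨fun z _ w _ _ => ?_, fun h3 => ?_⟩⟩
  · have : N ≤ (halG cls Nb L ∅ c z ∪ halG cls Nb L ∅ c w).card := by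
      rw [hG, hG]
      exact (h.listc z).trans (Finset.card_le_card Finset.subset_union_left)
    exact ⟨by omega, fun _ => this⟩
  · obtain ⟨z, hz⟩ := Finset.card_pos.1 (by omega : 0 < (Sp y).card)
    refine (h.listc z).trans (Finset.card_le_card ?_)
    rw [← hG z]
    exact Finset.subset_biUnion_of_mem (halG cls Nb L ∅ c) hz

theorem HalSys.cardG (h : HalSys N cls Nb Sp L) (S : Finset V) (c : V → ℕ) (z : V) :
    N + ((Nb z).filter (fun x => x ∉ S ∧ cls x ≠ cls z)).card ≤
      (halG cls Nb L S c z).card + 2 := by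
  have h1 := Finset.le_card_sdiff (((Nb z).filter (fun x => x ∈ S ∧ cls x ≠ cls z)).image c) (L z)
  have h2 : (((Nb z).filter (fun x => x ∈ S ∧ cls x ≠ cls z)).image c).card ≤ _ :=
    Finset.card_image_le
  have h3 : ((Nb z).filter (fun x => x ∈ S ∧ cls x ≠ cls z)).card +
      ((Nb z).filter (fun x => x ∉ S ∧ cls x ≠ cls z)).card ≤ (Nb z).card := by
    rw [← Finset.card_union_of_disjoint]
    · apply Finset.card_le_card
      intro x hx
      simp only [Finset.mem_union, Finset.mem_filter] at hx
      tauto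
    · rw [Finset.disjoint_left]
      intro x hx hx'
      simp only [Finset.mem_filter] at hx hx'
      tauto
  have h4 := h.card2 z
  have h5 := h.listc z
  simp only [halG]
  omega

theorem hal_three (s : Finset V) (hs : s.card ≤ 2) (a b c : V) (ha : a ∈ s) (hb : b ∈ s)
    (hc : c ∈ s) (hab : a ≠ b) (hac : a ≠ c) : b = c := by
  by_contra hbc
  have : ({a, b, c} : Finset V) ⊆ s := by
    intro x hx; simp at hx; rcases hx with rfl | rfl | rfl <;> assumption
  have := Finset.card_le_card this
  rw [Finset.card_eq_three.2 ⟨a, b, c, hab, hac, hbc, rfl⟩] at this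
  omega

theorem hal_halG_insert (S : Finset V) (c : V → ℕ) (x : V) (hx : x ∉ S) (a : ℕ)
    (hsymm : ∀ x z, z ∈ Nb x → x ∈ Nb z) (z : V) :
    halG cls Nb L (insert x S) (Function.update c x a) z =
      if z ∈ Nb x ∧ cls x ≠ cls z then (halG cls Nb L S c z).erase a else halG cls Nb L S c z := by
  have hup : ∀ w ∈ S, Function.update c x a w = c w := by
    intro w hw
    rw [Function.update_of_ne]
    rintro rfl; exact hx hw
  ext b
  have hz : z ∈ Nb x ↔ x ∈ Nb z := ⟨hsymm _ _, hsymm _ _⟩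
  split_ifs with h
  · simp only [halG, Finset.mem_sdiff, Finset.mem_erase, Finset.mem_image, Finset.mem_filter,
      Finset.mem_insert]
    constructor
    · rintro ⟨hb, hn⟩
      refine ⟨fun hba => hn ⟨x, ⟨hz.1 h.1, Or.inl rfl, h.2⟩, by simp [hba]⟩, hb, ?_⟩
      rintro ⟨w, ⟨h1, h2, h3⟩, h4⟩
      exact hn ⟨w, ⟨h1, Or.inr h2, h3⟩, by rw [hup w h2, h4]⟩
    · rintro ⟨hba, hb, hn⟩
      refine ⟨hb, ?_⟩
      rintro ⟨w, ⟨h1, h2, h3⟩, h4⟩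
      rcases h2 with rfl | h2
      · simp at h4; exact hba h4.symm
      · exact hn ⟨w, ⟨h1, h2, h3⟩, by rw [← hup w h2, h4]⟩
  · simp only [halG, Finset.mem_sdiff, Finset.mem_image, Finset.mem_filter,
      Finset.mem_insert]
    constructor
    · rintro ⟨hb, hn⟩
      refine ⟨hb, ?_⟩
      rintro ⟨w, ⟨h1, h2, h3⟩, h4⟩
      exact hn ⟨w, ⟨h1, Or.inr h2, h3⟩, by rw [hup w h2, h4]⟩
    · rintro ⟨hb, hn⟩
      refine ⟨hb, ?_⟩
      rintro ⟨w, ⟨h1, h2, h3⟩, h4⟩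
      rcases h2 with rfl | h2
      · exact h ⟨hz.2 h1, h3⟩
      · exact hn ⟨w, ⟨h1, h2, h3⟩, by rw [← hup w h2, h4]⟩

theorem HalInv_congr {Sp : Finset V} {G G' : V → Finset ℕ} {sh : V → V → Prop}
    (h : HalInv N Sp G sh) (hG : ∀ z ∈ Sp, G z = G' z) : HalInv N Sp G' sh := by
  refine ⟨fun z hz w hw hzw => ?_, fun h3 => ?_⟩
  · rw [← hG z hz, ← hG w hw]; exact h.1 z hz w hw hzw
  · have : Sp.biUnion G' = Sp.biUnion G := Finset.biUnion_congr rfl (fun z hz => (hG z hz).symm)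
    rw [this]; exact h.2 h3

theorem HalSys.badY (h : HalSys N cls Nb Sp L) (S : Finset V) (c : V → ℕ) (x : V) (hx : x ∉ S)
    (hSt : HalSt N cls Nb Sp L S c) (y : V) :
    ∃ Bad : Finset ℕ, Bad.card ≤ ((Nb x \ S).filter (fun z => cls z = y)).card ∧
      ((∀ z ∈ Sp y, z ∉ S) → ∀ a ∉ Bad, HalInv N (Sp y)
        (halG cls Nb L (insert x S) (Function.update c x a)) (halSh cls Nb (insert x S))) := by
  by_cases hy : ∀ z ∈ Sp y, z ∉ S
  swap
  · exact ⟨∅, by simp, fun h => absurd h hy⟩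
  obtain ⟨T, hTdef⟩ : ∃ T, T = (Sp y).filter (fun z => z ∈ Nb x ∧ cls x ≠ cls z) := ⟨_, rfl⟩
  have hTm : ∀ z, z ∈ T ↔ z ∈ Sp y ∧ z ∈ Nb x ∧ cls x ≠ cls z := by
    intro z; rw [hTdef, Finset.mem_filter]
  have hTsub : T ⊆ (Nb x \ S).filter (fun z => cls z = y) := by
    intro z hz
    have hz := (hTm z).1 hz
    simp only [Finset.mem_filter, Finset.mem_sdiff]
    exact ⟨⟨hz.2.1, hy z hz.1⟩, h.spc y z hz.1⟩
  have hTnb : T ⊆ Nb x := fun z hz => ((hTm z).1 hz).2.1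
  obtain ⟨Bad, hb1, hb2⟩ := hal_abs_bad N (Sp y) T (halG cls Nb L S c) (halSh cls Nb S)
    (halSh cls Nb (insert x S))
    (fun z => ((Nb z).filter (fun w => w ∉ insert x S ∧ cls w ≠ cls z)).card)
    (h.sp3 y) (fun z hz => ((hTm z).1 hz).1) ((Finset.card_le_card hTnb).trans (h.card2 x))
    (hSt.2.2 y hy)
    (by
      intro z hz
      refine le_trans ?_ (h.cardG S c z)
      rw [add_assoc]
      apply Nat.add_le_add_left
      split_ifs with hzT
      · have hzT := (hTm z).1 hzT
        have hlt : (Nb z).filter (fun w => w ∉ insert x S ∧ cls w ≠ cls z) ⊂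
            (Nb z).filter (fun w => w ∉ S ∧ cls w ≠ cls z) := by
          rw [Finset.ssubset_iff_of_subset]
          · refine ⟨x, ?_, ?_⟩
            · simp only [Finset.mem_filter]
              exact ⟨h.symm _ _ hzT.2.1, hx, hzT.2.2⟩
            · simp
          · intro w hw
            simp only [Finset.mem_filter, Finset.mem_insert, not_or] at hw ⊢
            tauto
        exact Finset.card_lt_card hlt
      · rw [add_zero]
        apply Finset.card_le_card
        intro w hw
        simp only [Finset.mem_filter, Finset.mem_insert, not_or] at hw ⊢
        tauto)
    (by
      rintro z w ⟨hzw, x', h1, h2⟩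
      exact ⟨hzw, x', fun hh => h1 (Finset.mem_insert_of_mem hh), h2⟩)
    (by
      rintro z w ⟨hzw, x', h1, h2, h3, h4, h5⟩
      constructor
      · exact Finset.card_pos.2 ⟨x', Finset.mem_filter.2 ⟨h4, h1, h2⟩⟩
      · exact Finset.card_pos.2 ⟨x', Finset.mem_filter.2 ⟨h5, h1, h3⟩⟩)
    (by
      rintro z w ⟨hzw, x', h1, h2, h3, h4, h5⟩
      exact ⟨hzw.symm, x', h1, h3, h2, h5, h4⟩)
    (by
      intro z hz w hw hzw
      have hz := (hTm z).1 hz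
      have hw := (hTm w).1 hw
      refine ⟨⟨hzw, x, hx, hz.2.2, hw.2.2, h.symm _ _ hz.2.1, h.symm _ _ hw.2.1⟩, ?_⟩
      rintro ⟨-, x', h1, h2, h3, h4, h5⟩
      have hxx : x ≠ x' := by rintro rfl; exact h1 (Finset.mem_insert_self _ _)
      exact h.noC4 x x' z w hxx hzw hz.2.1 hw.2.1 (h.symm _ _ h4) (h.symm _ _ h5))
    (by
      rintro z hz w hw w' hw' ⟨hzw, x1, a1, a2, a3, a4, a5⟩ ⟨hzw', x2, b1, b2, b3, b4, b5⟩
      have hz := (hTm z).1 hz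
      have n1 : x ≠ x1 := by rintro rfl; exact a1 (Finset.mem_insert_self _ _)
      have n2 : x ≠ x2 := by rintro rfl; exact b1 (Finset.mem_insert_self _ _)
      have e : x1 = x2 := hal_three _ (h.card2 z) x x1 x2 (h.symm _ _ hz.2.1) a4 b4 n1 n2
      subst e
      exact hal_three _ (h.card2 x1) z w w' (h.symm _ _ a4) (h.symm _ _ a5) (h.symm _ _ b5) hzw hzw')
  refine ⟨Bad, hb1.trans (Finset.card_le_card hTsub), fun _ a ha => ?_⟩
  refine HalInv_congr (hb2 a ha) (fun z hz => ?_)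
  rw [hal_halG_insert S c x hx a h.symm z]
  have : z ∈ T ↔ z ∈ Nb x ∧ cls x ≠ cls z := by
    rw [hTm]; tauto
  by_cases hzT : z ∈ T
  · rw [if_pos hzT, if_pos (this.1 hzT)]
  · rw [if_neg hzT, if_neg (fun hh => hzT (this.2 hh))]

theorem HalSys.step (h : HalSys N cls Nb Sp L) (S : Finset V) (c : V → ℕ) (x : V) (hx : x ∉ S)
    (hSt : HalSt N cls Nb Sp L S c) :
    ∃ B : Finset ℕ, B.card ≤ (Nb x).card ∧ ∀ a ∈ L x, a ∉ B →
      HalSt N cls Nb Sp L (insert x S) (Function.update c x a) := by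
  choose Bad hb1 hb2 using h.badY S c x hx hSt
  refine ⟨(Nb x ∩ S).image c ∪ ((Nb x \ S).image cls).biUnion Bad, ?_, ?_⟩
  · refine (Finset.card_union_le _ _).trans ?_
    have e1 : ((Nb x ∩ S).image c).card ≤ _ := Finset.card_image_le
    have e2 : (((Nb x \ S).image cls).biUnion Bad).card ≤ (Nb x \ S).card := by
      refine Finset.card_biUnion_le.trans ?_
      rw [Finset.card_eq_sum_card_image cls (Nb x \ S)]
      exact Finset.sum_le_sum (fun y _ => hb1 y)
    have e3 := Finset.card_inter_add_card_sdiff (Nb x) S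
    omega
  · intro a haL ha
    rw [Finset.mem_union, not_or] at ha
    have hBad : ∀ y, a ∉ Bad y := by
      intro y hay
      by_cases hy : y ∈ (Nb x \ S).image cls
      · exact ha.2 (Finset.mem_biUnion.2 ⟨y, hy, hay⟩)
      · have h1 := hb1 y
        have : (Nb x \ S).filter (fun z => cls z = y) = ∅ := by
          rw [Finset.filter_eq_empty_iff]
          intro z hz hzy
          exact hy (Finset.mem_image.2 ⟨z, hz, hzy⟩)
        rw [this, Finset.card_empty, Nat.le_zero, Finset.card_eq_zero] at h1
        rw [h1] at hay
        simp at hay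
    have hup : ∀ w ∈ S, Function.update c x a w = c w := by
      intro w hw
      rw [Function.update_of_ne]
      rintro rfl; exact hx hw
    have hac : ∀ z ∈ S, z ∈ Nb x → a ≠ c z := by
      intro z hz hzx hcz
      exact ha.1 (Finset.mem_image.2 ⟨z, Finset.mem_inter.2 ⟨hzx, hz⟩, hcz.symm⟩)
    refine ⟨?_, ?_, ?_⟩
    · intro w hw
      rcases Finset.mem_insert.1 hw with rfl | hw
      · simpa using haL
      · rw [hup w hw]; exact hSt.1 w hw
    · intro w hw z hz hzw hcl
      have hw0 := Finset.mem_insert.1 hw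
      have hz0 := Finset.mem_insert.1 hz
      clear hw hz
      rcases hw0 with rfl | hw <;> rcases hz0 with rfl | hz
      · exact absurd rfl hcl
      · rw [hup z hz]; simpa using hac z hz hzw
      · rw [hup w hw]; simpa using (hac w hw (h.symm _ _ hzw)).symm
      · rw [hup w hw, hup z hz]; exact hSt.2.1 w hw z hz hzw hcl
    · intro y hy
      exact hb2 y (fun z hz hzS => hy z hz (Finset.mem_insert_of_mem hzS)) a (hBad y)

/-- greedy colouring of a set of vertices -/
theorem HalSys.greedy (h : HalSys N cls Nb Sp L) (S : Finset V) (c : V → ℕ)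
    (hSt : HalSt N cls Nb Sp L S c) (F : Finset ℕ) (b : ℕ) (Q : Finset V) :
    (∀ x ∈ Q, x ∉ S) → (∀ x ∈ Q, (Nb x).card ≤ b) → F.card + Q.card + b ≤ N →
    ∃ c' : V → ℕ, HalSt N cls Nb Sp L (S ∪ Q) c' ∧ (∀ x, x ∉ Q → c' x = c x) ∧
      (∀ x ∈ Q, ∀ z ∈ Q, c' x = c' z → x = z) ∧ ∀ x ∈ Q, c' x ∉ F := by
  induction Q using Finset.induction_on with
  | empty => intro _ _ _; exact ⟨c, by simpa using hSt, by simp, by simp, by simp⟩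
  | insert x Q hxQ ih =>
    intro h1 h2 h3
    rw [Finset.card_insert_of_notMem hxQ] at h3
    obtain ⟨c1, k1, k2, k3, k4⟩ := ih (fun z hz => h1 z (Finset.mem_insert_of_mem hz))
      (fun z hz => h2 z (Finset.mem_insert_of_mem hz)) (by omega)
    have hxS : x ∉ S ∪ Q := by
      simp [h1 x (Finset.mem_insert_self _ _), hxQ]
    obtain ⟨B, hB1, hB2⟩ := h.step (S ∪ Q) c1 x hxS k1
    have hb := h2 x (Finset.mem_insert_self _ _)
    have hcard : (F ∪ Q.image c1 ∪ B).card < (L x).card := by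
      have e1 := Finset.card_union_le (F ∪ Q.image c1) B
      have e2 := Finset.card_union_le F (Q.image c1)
      have e3 : (Q.image c1).card ≤ _ := Finset.card_image_le
      have e4 := h.listc x
      omega
    obtain ⟨a, ha1, ha2⟩ := Finset.exists_mem_notMem_of_card_lt_card hcard
    simp only [Finset.mem_union, not_or, Finset.mem_image, not_exists, not_and] at ha2
    have hup : ∀ w ∈ Q, Function.update c1 x a w = c1 w := by
      intro w hw
      rw [Function.update_of_ne]
      rintro rfl; exact hxQ hw
    refine ⟨Function.update c1 x a, ?_, ?_, ?_, ?_⟩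
    · have : S ∪ insert x Q = insert x (S ∪ Q) := by
        ext w; simp only [Finset.mem_union, Finset.mem_insert]; tauto
      rw [this]
      exact hB2 a ha1 ha2.2
    · intro w hw
      simp only [Finset.mem_insert, not_or] at hw
      rw [Function.update_of_ne hw.1]
      exact k2 w hw.2
    · intro w hw z hz hwz
      have hw0 := Finset.mem_insert.1 hw
      have hz0 := Finset.mem_insert.1 hz
      clear hw hz
      rcases hw0 with rfl | hw <;> rcases hz0 with rfl | hz
      · rfl
      · rw [hup z hz, Function.update_self] at hwz
        exact absurd hwz.symm (ha2.1.2 z hz)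
      · rw [hup w hw, Function.update_self] at hwz
        exact absurd hwz (ha2.1.2 w hw)
      · rw [hup w hw, hup z hz] at hwz
        exact k3 w hw z hz hwz
    · intro w hw
      rcases Finset.mem_insert.1 hw with rfl | hw
      · rw [Function.update_self]; exact ha2.1.1
      · rw [hup w hw]; exact k4 w hw

/-- colouring the special vertices of one class -/
theorem HalSys.special (h : HalSys N cls Nb Sp L) (S : Finset V) (c : V → ℕ)
    (hSt : HalSt N cls Nb Sp L S c) (y : V) (hy : ∀ z ∈ Sp y, z ∉ S) (X : Finset ℕ)
    (hX : Sp y ≠ ∅ → X.card + 3 ≤ N) :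
    ∃ c' : V → ℕ, HalSt N cls Nb Sp L (S ∪ Sp y) c' ∧ (∀ x, x ∉ Sp y → c' x = c x) ∧
      (∀ x ∈ Sp y, ∀ z ∈ Sp y, c' x = c' z → x = z) ∧ ∀ x ∈ Sp y, c' x ∉ X := by
  by_cases hne : Sp y = ∅
  · exact ⟨c, by rw [hne]; simpa using hSt, fun _ _ => rfl, by simp [hne], by simp [hne]⟩
  obtain ⟨a, ha1, ha2⟩ := hal_hall N (Sp y) (halG cls Nb L S c) (halSh cls Nb S) X (h.sp3 y)
    (hSt.2.2 y hy) (fun z _ => (Nat.le_add_right _ _).trans (h.cardG S c z)) (hX hne)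
  have hS : ∀ w ∈ S, (if w ∈ Sp y then a w else c w) = c w := fun w hw =>
    if_neg (fun hh => hy w hh hw)
  have hQ : ∀ w ∈ Sp y, (if w ∈ Sp y then a w else c w) = a w := fun w hw => if_pos hw
  have haG : ∀ z ∈ Sp y, ∀ w ∈ S, w ∈ Nb z → cls w ≠ cls z → a z ≠ c w := by
    intro z hz w hw hwz hcl hac
    have := (ha1 z hz).1
    rw [halG, Finset.mem_sdiff] at this
    exact this.2 (Finset.mem_image.2 ⟨w, Finset.mem_filter.2 ⟨hwz, hw, hcl⟩, hac.symm⟩)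
  refine ⟨fun w => if w ∈ Sp y then a w else c w, ⟨?_, ?_, ?_⟩, ?_, ?_, ?_⟩
  · intro w hw
    rcases Finset.mem_union.1 hw with hw | hw
    · simp only [hS w hw]; exact hSt.1 w hw
    · simp only [hQ w hw]
      exact (Finset.mem_sdiff.1 (ha1 w hw).1).1
  · intro w hw z hz hzw hcl
    rcases Finset.mem_union.1 hw with hw | hw <;> rcases Finset.mem_union.1 hz with hz | hz
    · simp only [hS w hw, hS z hz]; exact hSt.2.1 w hw z hz hzw hcl
    · simp only [hS w hw, hQ z hz]
      exact (haG z hz w hw (h.symm _ _ hzw) hcl).symm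
    · simp only [hS z hz, hQ w hw]
      exact haG w hw z hz hzw hcl.symm
    · exact absurd hzw (h.indep y y w hw z hz)
  · intro y' hy'
    have hI := hSt.2.2 y' (fun z hz hzS => hy' z hz (Finset.mem_union_left _ hzS))
    have hI' : HalInv N (Sp y') (halG cls Nb L S c) (halSh cls Nb (S ∪ Sp y)) := by
      refine ⟨fun z hz w hw hzw => ⟨(hI.1 z hz w hw hzw).1, fun hh => (hI.1 z hz w hw hzw).2 ?_⟩, hI.2⟩
      obtain ⟨h1, x', h2, h3⟩ := hh
      exact ⟨h1, x', fun hh => h2 (Finset.mem_union_left _ hh), h3⟩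
    refine HalInv_congr hI' (fun z hz => ?_)
    simp only [halG]
    congr 1
    have e : (Nb z).filter (fun x => x ∈ S ∪ Sp y ∧ cls x ≠ cls z) =
        (Nb z).filter (fun x => x ∈ S ∧ cls x ≠ cls z) := by
      apply Finset.filter_congr
      intro w hw
      have : w ∉ Sp y := fun hh => h.indep y' y z hz w hh hw
      simp [this]
    rw [e]
    apply Finset.image_congr
    intro w hw
    simp only [Finset.coe_filter] at hw
    exact (hS w hw.2.1).symm
  · intro w hw; simp [hw]
  · intro w hw z hz hh
    simp only [hQ w hw, hQ z hz] at hh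
    exact ha2 w hw z hz hh
  · intro w hw
    simp only [hQ w hw]
    exact (ha1 w hw).2

/-- colouring one class -/
theorem HalSys.classStep (h : HalSys N cls Nb Sp L) (S : Finset V) (c : V → ℕ)
    (hSt : HalSt N cls Nb Sp L S c) (y : V) (Ch : Finset V) (hCh : ∀ x ∈ Ch, x ∉ S)
    (hSpC : Sp y ⊆ Ch) (n : ℕ) (hCn : Ch.card ≤ n)
    (h1 : (Ch.filter (fun x => x ∉ Sp y ∧ (Nb x).Nonempty)).card + 2 ≤ n)
    (h2 : Sp y ≠ ∅ → (Ch.filter (fun x => x ∉ Sp y ∧ (Nb x).Nonempty)).card + 3 ≤ n)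
    (FC : Finset ℕ) (hFC : FC.card + n ≤ N) :
    ∃ c' : V → ℕ, HalSt N cls Nb Sp L (S ∪ Ch) c' ∧ (∀ x, x ∉ Ch → c' x = c x) ∧
      (∀ x ∈ Ch, ∀ z ∈ Ch, c' x = c' z → x = z) ∧ ∀ x ∈ Ch, c' x ∉ FC := by
  obtain ⟨A, hA⟩ : ∃ A, A = Ch.filter (fun x => x ∉ Sp y ∧ (Nb x).Nonempty) := ⟨_, rfl⟩
  obtain ⟨E, hE⟩ : ∃ E, E = Ch.filter (fun x => x ∉ Sp y ∧ ¬ (Nb x).Nonempty) := ⟨_, rfl⟩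
  have mA : ∀ x, x ∈ A ↔ x ∈ Ch ∧ x ∉ Sp y ∧ (Nb x).Nonempty := by
    intro x; rw [hA, Finset.mem_filter]
  have mE : ∀ x, x ∈ E ↔ x ∈ Ch ∧ x ∉ Sp y ∧ ¬ (Nb x).Nonempty := by
    intro x; rw [hE, Finset.mem_filter]
  rw [← hA] at h1 h2
  obtain ⟨c1, a1, a2, a3, a4⟩ := h.greedy S c hSt FC 2 A (fun x hx => hCh x ((mA x).1 hx).1)
    (fun x _ => h.card2 x) (by omega)
  have iA : (A.image c1).card ≤ _ := Finset.card_image_le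
  obtain ⟨c2, b1, b2, b3, b4⟩ := h.special (S ∪ A) c1 a1 y (by
      intro z hz hz'
      rcases Finset.mem_union.1 hz' with hz' | hz'
      · exact hCh z (hSpC hz) hz'
      · exact ((mA z).1 hz').2.1 hz) (FC ∪ A.image c1) (by
      intro hne
      have := h2 hne
      have := Finset.card_union_le FC (A.image c1)
      omega)
  have hAc2 : ∀ x ∈ A, c2 x = c1 x := fun x hx => b2 x ((mA x).1 hx).2.1
  have hsum : (A ∪ Sp y).card + E.card = Ch.card := by
    rw [← Finset.card_union_of_disjoint]
    · congr 1
      ext x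
      simp only [Finset.mem_union, mA, mE]
      have := @hSpC x
      tauto
    · rw [Finset.disjoint_left]
      intro x hx hx'
      simp only [Finset.mem_union, mA, mE] at hx hx'
      tauto
  have iB : ((A ∪ Sp y).image c2).card ≤ _ := Finset.card_image_le
  obtain ⟨c3, d1, d2, d3, d4⟩ := h.greedy (S ∪ A ∪ Sp y) c2 b1 (FC ∪ (A ∪ Sp y).image c2) 0 E (by
      intro x hx
      have hx := (mE x).1 hx
      have := hCh x hx.1
      simp only [Finset.mem_union, mA]
      tauto) (by
      intro x hx
      have hx := (mE x).1 hx
      rw [Finset.not_nonempty_iff_eq_empty] at hx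
      simp [hx.2.2]) (by
      have := Finset.card_union_le FC ((A ∪ Sp y).image c2)
      omega)
  have hAE : ∀ x ∈ A, x ∉ E := by
    intro x hx hx'
    exact ((mE x).1 hx').2.2 ((mA x).1 hx).2.2
  have hSE : ∀ x ∈ Sp y, x ∉ E := fun x hx hx' => ((mE x).1 hx').2.1 hx
  have hSe : S ∪ A ∪ Sp y ∪ E = S ∪ Ch := by
    ext x
    simp only [Finset.mem_union, mA, mE]
    have := @hSpC x
    tauto
  have hcases : ∀ x ∈ Ch, (x ∈ A ∧ c3 x = c1 x) ∨ (x ∈ Sp y ∧ c3 x = c2 x) ∨ x ∈ E := by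
    intro x hx
    by_cases hs : x ∈ Sp y
    · right; left; exact ⟨hs, d2 x (hSE x hs)⟩
    · by_cases hb : (Nb x).Nonempty
      · left
        have hxA := (mA x).2 ⟨hx, hs, hb⟩
        exact ⟨hxA, by rw [d2 x (hAE x hxA), hAc2 x hxA]⟩
      · right; right; exact (mE x).2 ⟨hx, hs, hb⟩
  have nAS : ∀ x ∈ A, ∀ z ∈ Sp y, c1 x ≠ c2 z := by
    intro x hx z hz hh
    apply b4 z hz
    rw [← hh]
    exact Finset.mem_union_right _ (Finset.mem_image_of_mem _ hx)
  have nAE : ∀ x ∈ A, ∀ z ∈ E, c1 x ≠ c3 z := by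
    intro x hx z hz hh
    apply d4 z hz
    rw [← hh, ← hAc2 x hx]
    exact Finset.mem_union_right _ (Finset.mem_image_of_mem _ (Finset.mem_union_left _ hx))
  have nSE : ∀ x ∈ Sp y, ∀ z ∈ E, c2 x ≠ c3 z := by
    intro x hx z hz hh
    apply d4 z hz
    rw [← hh]
    exact Finset.mem_union_right _ (Finset.mem_image_of_mem _ (Finset.mem_union_right _ hx))
  refine ⟨c3, hSe ▸ d1, ?_, ?_, ?_⟩
  · intro x hx
    have e1 : x ∉ E := fun hh => hx ((mE x).1 hh).1
    have e2 : x ∉ Sp y := fun hh => hx (hSpC hh)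
    have e3 : x ∉ A := fun hh => hx ((mA x).1 hh).1
    rw [d2 x e1, b2 x e2, a2 x e3]
  · intro x hx z hz hh
    rcases hcases x hx with ⟨x1, x2⟩ | ⟨x1, x2⟩ | x1 <;>
      rcases hcases z hz with ⟨z1, z2⟩ | ⟨z1, z2⟩ | z1
    · exact a3 x x1 z z1 (by rw [← x2, ← z2, hh])
    · exact absurd (by rw [← x2, ← z2, hh]) (nAS x x1 z z1)
    · exact absurd (by rw [← x2, hh]) (nAE x x1 z z1)
    · exact absurd (by rw [← x2, ← z2, hh]) (nAS z z1 x x1)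
    · exact b3 x x1 z z1 (by rw [← x2, ← z2, hh])
    · exact absurd (by rw [← x2, hh]) (nSE x x1 z z1)
    · exact absurd (by rw [← z2, hh]) (nAE z z1 x x1)
    · exact absurd (by rw [← z2, hh]) (nSE z z1 x x1)
    · exact d3 x x1 z z1 hh
  · intro x hx
    rcases hcases x hx with ⟨x1, x2⟩ | ⟨x1, x2⟩ | x1
    · rw [x2]; exact a4 x x1
    · rw [x2]; exact fun hh => b4 x x1 (Finset.mem_union_left _ hh)
    · exact fun hh => d4 x x1 (Finset.mem_union_left _ hh)

end

/-! ### Top-down colouring of the rooted tree -/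

structure HalRoot {V : Type*} (T : SimpleGraph V) (r0 : V) (par : V → V) (dep : V → ℕ) : Prop where
  adj : ∀ y u, T.Adj y u ↔ (y ≠ r0 ∧ u = par y) ∨ (u ≠ r0 ∧ y = par u)
  dep : ∀ v, v ≠ r0 → dep v = dep (par v) + 1

noncomputable def halCh {V : Type*} [Fintype V] (r0 : V) (par : V → V) (y : V) : Finset V :=
  Finset.univ.filter (fun v => v ≠ r0 ∧ par v = y)

theorem mem_halCh {V : Type*} [Fintype V] {r0 : V} {par : V → V} {y v : V} :
    v ∈ halCh r0 par y ↔ v ≠ r0 ∧ par v = y := by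
  simp [halCh]

noncomputable def halCol {V : Type*} (r0 : V) (par : V → V) (c : V → ℕ) (p u : V) : ℕ :=
  if p ≠ r0 ∧ u = par p then c p else c u

structure HalQ {V : Type*} [Fintype V] (T : SimpleGraph V) (r0 : V) (par : V → V) (D : ℕ)
    (c : V → ℕ) (R : V → V → V → Prop) (y : V) : Prop where
  inj : ∀ v, v ≠ r0 → par v = y → ∀ v', v' ≠ r0 → par v' = y → c v = c v' → v = v'
  ne : y ≠ r0 → ∀ v, v ≠ r0 → par v = y → c v ≠ c y
  av : y ≠ r0 → ∀ v, v ≠ r0 → par v = y → ∀ u, T.Adj (par y) u → R (par y) u y →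
    c v ≠ halCol r0 par c (par y) u
  tot : ∀ u v, T.Adj y u → T.Adj y v → u ≠ v → R y u v ∨ R y v u
  inD : ∀ v, T.Adj y v → (Finset.univ.filter (fun u => T.Adj y u ∧ R y u v)).card ≤ D
  outD : ∀ v, T.Adj y v → (Finset.univ.filter (fun u => T.Adj y u ∧ u ≠ v ∧ ¬ R y u v)).card ≤ D
  up : y ≠ r0 → ∀ v, v ≠ r0 → par v = y → ∀ u, T.Adj (par y) u →
    c v = halCol r0 par c (par y) u → R y (par y) v

section
set_option linter.unusedSectionVars false
variable {V : Type*} [Fintype V] {T : SimpleGraph V} {r0 : V} {par : V → V} {dep : V → ℕ}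

theorem HalRoot.par_ne (hr : HalRoot T r0 par dep) {v : V} (hv : v ≠ r0) : par v ≠ v := by
  intro h
  have := hr.dep v hv
  rw [h] at this
  omega

theorem HalRoot.par_par_ne (hr : HalRoot T r0 par dep) {v : V} (hv : v ≠ r0) (h : par v ≠ r0) :
    par (par v) ≠ v := by
  intro h'
  have := hr.dep v hv
  have := hr.dep _ h
  rw [h'] at this
  omega

theorem HalRoot.adj_par (hr : HalRoot T r0 par dep) {v : V} (hv : v ≠ r0) : T.Adj (par v) v :=
  (hr.adj _ _).2 (Or.inr ⟨hv, rfl⟩)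

theorem HalRoot.col_child (hr : HalRoot T r0 par dep) (c : V → ℕ) {v : V} (hv : v ≠ r0) :
    halCol r0 par c (par v) v = c v := by
  rw [halCol, if_neg]
  rintro ⟨h1, h2⟩
  exact hr.par_par_ne hv h1 h2.symm

theorem hal_topdown (hr : HalRoot T r0 par dep) {N : ℕ} {Nb Sp : V → Finset V}
    {L : V → Finset ℕ} (hs : HalSys N par Nb Sp L) (D n : ℕ)
    (hdeg : ∀ y, y ≠ r0 → (Finset.univ.filter (fun u => T.Adj y u)).card ≤ 2 * D + 1)
    (hdeg0 : ∀ u v, T.Adj r0 u → T.Adj r0 v → u = v)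
    (hN : D + 1 + n ≤ N) (hCn : ∀ y, (halCh r0 par y).card ≤ n)
    (hSp : ∀ y, Sp y ⊆ halCh r0 par y)
    (h1 : ∀ y, ((halCh r0 par y).filter (fun x => x ∉ Sp y ∧ (Nb x).Nonempty)).card + 2 ≤ n)
    (h2 : ∀ y, Sp y ≠ ∅ →
      ((halCh r0 par y).filter (fun x => x ∉ Sp y ∧ (Nb x).Nonempty)).card + 3 ≤ n) :
    ∃ (c : V → ℕ) (R : V → V → V → Prop), (∀ v, v ≠ r0 → c v ∈ L v) ∧
      (∀ v w, v ≠ r0 → w ≠ r0 → w ∈ Nb v → par v ≠ par w → c v ≠ c w) ∧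
      ∀ y, HalQ T r0 par D c R y := by
  have main : ∀ P : Finset V, (∀ y ∈ P, y ≠ r0 → par y ∈ P) →
      ∃ (c : V → ℕ) (R : V → V → V → Prop),
        HalSt N par Nb Sp L (Finset.univ.filter (fun v => v ≠ r0 ∧ par v ∈ P)) c ∧
        ∀ y ∈ P, HalQ T r0 par D c R y := by
    intro P
    induction P using Finset.induction_on_max_value dep with
    | empty =>
      intro _
      refine ⟨fun _ => 0, fun _ _ _ => False, ?_, by simp⟩
      simpa using hs.start (fun _ => 0)
    | insert a P haP hmax ih =>
      intro hcl
      have hclP : ∀ y ∈ P, y ≠ r0 → par y ∈ P := by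
        intro y hy hy0
        rcases Finset.mem_insert.1 (hcl y (Finset.mem_insert_of_mem hy) hy0) with h | h
        · have e1 := hmax y hy
          have e2 := hr.dep y hy0
          rw [h] at e2
          omega
        · exact h
      obtain ⟨c, R, hSt, hQ⟩ := ih hclP
      have hpa : a ≠ r0 → par a ∈ P := by
        intro ha0
        rcases Finset.mem_insert.1 (hcl a (Finset.mem_insert_self _ _) ha0) with h | h
        · exact absurd h (hr.par_ne ha0)
        · exact h
      obtain ⟨FC, hFC⟩ : ∃ FC : Finset ℕ, FC = if a = r0 then ∅ else
        insert (c a) ((Finset.univ.filter (fun u => T.Adj (par a) u ∧ R (par a) u a)).image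
          (halCol r0 par c (par a))) := ⟨_, rfl⟩
      have hFCc : FC.card ≤ D + 1 := by
        rw [hFC]
        split_ifs with h
        · simp
        · refine (Finset.card_insert_le _ _).trans ?_
          have := (hQ _ (hpa h)).inD a (hr.adj_par h)
          exact Nat.add_le_add_right (Finset.card_image_le.trans this) 1
      obtain ⟨c', k1, k2, k3, k4⟩ := hs.classStep _ c hSt a (halCh r0 par a)
        (by
          intro x hx
          rw [mem_halCh] at hx
          simp only [Finset.mem_filter, Finset.mem_univ, true_and, not_and]
          intro _
          rw [hx.2]; exact haP)
        (hSp a) n (hCn a) (h1 a) (h2 a) FC (by omega)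
      have kk : ∀ x, (x = r0 ∨ par x ≠ a) → c' x = c x := by
        intro x hx
        apply k2
        rw [mem_halCh]
        tauto
      have kP : ∀ x ∈ P, c' x = c x := by
        intro x hx
        apply kk
        by_cases h : x = r0
        · exact Or.inl h
        · right
          intro hh
          exact haP (hh ▸ hclP x hx h)
      have ka : c' a = c a := by
        apply kk
        by_cases h : a = r0
        · exact Or.inl h
        · exact Or.inr (hr.par_ne h)
      have kcol : ∀ p ∈ P, ∀ u, T.Adj p u → halCol r0 par c' p u = halCol r0 par c p u := by
        intro p hp u hu
        rw [halCol, halCol]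
        split_ifs with h
        · exact kP p hp
        · rcases (hr.adj _ _).1 hu with h' | h'
          · exact absurd h' h
          · apply kk; right
            rw [← h'.2]
            rintro rfl; exact haP hp
      -- the orientation at a
      have hR : ∃ Ra : V → V → Prop,
          (∀ u v, T.Adj a u → T.Adj a v → u ≠ v → Ra u v ∨ Ra v u) ∧
          (∀ v, T.Adj a v → (Finset.univ.filter (fun u => T.Adj a u ∧ Ra u v)).card ≤ D) ∧
          (∀ v, T.Adj a v →
            (Finset.univ.filter (fun u => T.Adj a u ∧ u ≠ v ∧ ¬ Ra u v)).card ≤ D) ∧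
          (a ≠ r0 → ∀ v, v ≠ r0 → par v = a → ∀ u, T.Adj (par a) u →
            c' v = halCol r0 par c' (par a) u → Ra (par a) v) := by
        by_cases ha0 : a = r0
        · obtain ⟨F, hF⟩ : ∃ F : V → V → Prop, ∀ u v, ¬ F u v := ⟨fun _ _ => False, fun _ _ h => h⟩
          refine ⟨F, ?_, ?_, ?_, fun h => absurd ha0 h⟩
          · intro u v hu hv huv
            rw [ha0] at hu hv
            exact absurd (hdeg0 u v hu hv) huv
          · simp [hF]
          · intro v hv
            rw [Finset.card_eq_zero.2]
            · exact Nat.zero_le _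
            · apply Finset.eq_empty_of_forall_notMem
              intro u hu'
              obtain ⟨hu, huv, -⟩ := (Finset.mem_filter.1 hu').2
              rw [ha0] at hu hv
              exact huv (hdeg0 u v hu hv)
        · have hp := hQ _ (hpa ha0)
          have haa := hr.adj_par ha0
          obtain ⟨O, hO⟩ : ∃ O, O = (halCh r0 par a).filter (fun v => ∃ u, T.Adj (par a) u ∧
            c' v = halCol r0 par c' (par a) u) := ⟨_, rfl⟩
          have mO : ∀ v, v ∈ O ↔ (v ≠ r0 ∧ par v = a) ∧ ∃ u, T.Adj (par a) u ∧
              c' v = halCol r0 par c' (par a) u := by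
            intro v; rw [hO, Finset.mem_filter, mem_halCh]
          have hOc : O.card ≤ D := by
            have hsub : O.image c' ⊆ (Finset.univ.filter (fun u => T.Adj (par a) u ∧ u ≠ a ∧
                ¬ R (par a) u a)).image (halCol r0 par c (par a)) := by
              intro b hb
              obtain ⟨v, hv, rfl⟩ := Finset.mem_image.1 hb
              obtain ⟨hv1, u, hu, hcu⟩ := (mO v).1 hv
              have hav := k4 v (mem_halCh.2 hv1)
              rw [hFC, if_neg ha0, Finset.mem_insert, not_or, Finset.mem_image] at hav
              rw [kcol _ (hpa ha0) u hu] at hcu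
              refine Finset.mem_image.2 ⟨u, ?_, hcu.symm⟩
              simp only [Finset.mem_filter, Finset.mem_univ, true_and]
              refine ⟨hu, ?_, ?_⟩
              · rintro rfl
                rw [hr.col_child c ha0] at hcu
                exact hav.1 hcu
              · intro hRu
                exact hav.2 ⟨u, by simp [hu, hRu], hcu.symm⟩
            have e1 := Finset.card_le_card hsub
            have e2 : (O.image c').card = O.card := by
              apply Finset.card_image_of_injOn
              intro v hv w hw hvw
              have hv := ((mO v).1 hv).1
              have hw := ((mO w).1 hw).1
              exact k3 v (mem_halCh.2 hv) w (mem_halCh.2 hw) hvw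
            have e3 := hp.outD a haa
            have e4 := @Finset.card_image_le _ _ (Finset.univ.filter (fun u => T.Adj (par a) u ∧ u ≠ a ∧
                ¬ R (par a) u a)) (halCol r0 par c (par a)) _
            omega
          obtain ⟨Ra, r1, r2, r3, r4⟩ := hal_tour (Finset.univ.filter (fun u => T.Adj a u)) O
            (par a) D (hdeg a ha0) (by simpa using haa.symm)
            (by
              intro v hv
              have := ((mO v).1 hv).1
              simp only [Finset.mem_filter, Finset.mem_univ, true_and]
              rw [← this.2]
              exact hr.adj_par this.1)
            (by
              intro hv
              have := ((mO _).1 hv).1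
              exact hr.par_par_ne ha0 this.1 this.2)
            hOc
          simp only [Finset.mem_filter, Finset.mem_univ, true_and, Finset.filter_filter] at r1 r2 r3
          refine ⟨Ra, fun u v hu hv => r1 u hu v hv, r2, r3, ?_⟩
          intro _ v hv hpv u hu hcu
          exact r4 v ((mO v).2 ⟨⟨hv, hpv⟩, u, hu, hcu⟩)
      obtain ⟨Ra, r1, r2, r3, r4⟩ := hR
      refine ⟨c', Function.update R a Ra, ?_, ?_⟩
      · convert k1 using 1
        ext v
        simp only [Finset.mem_filter, Finset.mem_univ, true_and, Finset.mem_union, mem_halCh,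
          Finset.mem_insert]
        tauto
      · intro y hy
        rcases Finset.mem_insert.1 hy with rfl | hyP
        · constructor
          · intro v hv hpv v' hv' hpv' hcc
            exact k3 v (mem_halCh.2 ⟨hv, hpv⟩) v' (mem_halCh.2 ⟨hv', hpv'⟩) hcc
          · intro hy0 v hv hpv hcc
            have hav := k4 v (mem_halCh.2 ⟨hv, hpv⟩)
            rw [hFC, if_neg hy0, Finset.mem_insert, not_or] at hav
            exact hav.1 (hcc.trans ka)
          · intro hy0 v hv hpv u hu hRu hcc
            have hav := k4 v (mem_halCh.2 ⟨hv, hpv⟩)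
            rw [hFC, if_neg hy0, Finset.mem_insert, not_or, Finset.mem_image] at hav
            rw [Function.update_of_ne (hr.par_ne hy0)] at hRu
            rw [kcol _ (hpa hy0) u hu] at hcc
            exact hav.2 ⟨u, by simp [hu, hRu], hcc.symm⟩
          · simpa using r1
          · simpa using r2
          · simpa using r3
          · simpa using r4
        · have hya : y ≠ a := by rintro rfl; exact haP hyP
          have q := hQ y hyP
          have kc : ∀ v, v ≠ r0 → par v = y → c' v = c v := by
            intro v _ hpv
            apply kk; right; rw [hpv]; exact hya
          have hpya : y ≠ r0 → par y ≠ a := by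
            intro hy0 hh; exact haP (hh ▸ hclP y hyP hy0)
          constructor
          · intro v hv hpv v' hv' hpv'
            rw [kc v hv hpv, kc v' hv' hpv']
            exact q.inj v hv hpv v' hv' hpv'
          · intro hy0 v hv hpv
            rw [kc v hv hpv, kP y hyP]
            exact q.ne hy0 v hv hpv
          · intro hy0 v hv hpv u hu
            rw [kc v hv hpv, kcol _ (hclP y hyP hy0) u hu, Function.update_of_ne (hpya hy0)]
            exact q.av hy0 v hv hpv u hu
          · rw [Function.update_of_ne hya]; exact q.tot
          · rw [Function.update_of_ne hya]; exact q.inD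
          · rw [Function.update_of_ne hya]; exact q.outD
          · intro hy0 v hv hpv u hu
            rw [kc v hv hpv, kcol _ (hclP y hyP hy0) u hu, Function.update_of_ne hya]
            exact q.up hy0 v hv hpv u hu
  obtain ⟨c, R, hSt, hQ⟩ := main Finset.univ (by simp)
  refine ⟨c, R, ?_, ?_, fun y => hQ y (Finset.mem_univ _)⟩
  · intro v hv; exact hSt.1 v (by simpa using hv)
  · intro v w hv hw hwv hcl
    exact hSt.2.1 v (by simpa using hv) w (by simpa using hw) hwv hcl

end

/-! ### Indexing the cycle -/
theorem hal_cycle_index {V : Type*} [Fintype V] (C : SimpleGraph V) (v0 : V) (h0 : C.degree v0 = 2)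
    (hd : ∀ v, C.degree v = 0 ∨ C.degree v = 2)
    (hc : ∀ u v, C.degree u = 2 → C.degree v = 2 → C.Reachable u v) :
    ∃ (l : ℕ) (x : ZMod l → V), 3 ≤ l ∧ Function.Injective x ∧
      (∀ v, C.degree v = 2 ↔ ∃ i, x i = v) ∧ ∀ i v, C.Adj (x i) v ↔ v = x (i + 1) ∨ v = x (i - 1) := by
  have hcyc : C.IsCycles := by
    intro v hv
    rw [← Nat.card_coe_set_eq, Nat.card_eq_fintype_card, card_neighborSet_eq_degree]
    obtain ⟨w, hw⟩ := hv
    rcases hd v with h | h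
    · have : 0 < C.degree v := (C.degree_pos_iff_exists_adj v).2 ⟨w, hw⟩
      omega
    · exact h
  have hne : (C.neighborSet v0).Nonempty := by
    obtain ⟨w, hw⟩ := (C.degree_pos_iff_exists_adj v0).1 (by omega)
    exact ⟨w, hw⟩
  obtain ⟨p, hp, hs⟩ := hcyc.exists_cycle_toSubgraph_verts_eq_connectedComponentSupp
    (c := C.connectedComponentMk v0) (v := v0) (by simp) hne
  have hl := hp.three_le_length
  obtain ⟨l, hlp⟩ : ∃ l, l = p.length := ⟨_, rfl⟩
  rw [← hlp] at hl
  have : NeZero l := ⟨by omega⟩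
  have hinj : Function.Injective (fun i : ZMod l => p.getVert i.val) := by
    intro i j hij
    have hi := ZMod.val_lt i
    have hj := ZMod.val_lt j
    apply ZMod.val_injective
    apply hp.getVert_injOn' _ _ hij
    · simp only [Set.mem_ofPred_eq]; omega
    · simp only [Set.mem_ofPred_eq]; omega
  have hadj : ∀ i : ZMod l, C.Adj (p.getVert i.val) (p.getVert (i + 1).val) := by
    intro i
    have hi := ZMod.val_lt i
    have h1 := hal_val_add i 1 (by omega)
    rw [Nat.cast_one] at h1
    have h2 := p.adj_getVert_succ (i := i.val) (by omega)
    by_cases h : i.val + 1 < l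
    · rw [h1, if_pos h]; exact h2
    · rw [h1, if_neg h]
      have e : i.val + 1 - l = 0 := by omega
      have e2 : i.val + 1 = p.length := by omega
      rw [e2, p.getVert_length] at h2
      rw [e, p.getVert_zero]; exact h2
  have hdeg : ∀ v, C.degree v = 2 ↔ ∃ i : ZMod l, p.getVert i.val = v := by
    intro v
    constructor
    · intro hv
      have : v ∈ p.toSubgraph.verts := by
        rw [hs]; simp only [ConnectedComponent.mem_supp_iff, ConnectedComponent.eq]
        exact hc v v0 hv h0
      rw [Walk.mem_verts_toSubgraph, Walk.mem_support_iff_exists_getVert] at this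
      obtain ⟨m, hm, hml⟩ := this
      by_cases h : m < l
      · exact ⟨(m : ZMod l), by rw [ZMod.val_natCast_of_lt h, hm]⟩
      · have : m = p.length := by omega
        rw [this, p.getVert_length] at hm
        exact ⟨0, by rw [ZMod.val_zero, p.getVert_zero, hm]⟩
    · rintro ⟨i, rfl⟩
      rcases hd (p.getVert i.val) with h | h
      · have : 0 < C.degree (p.getVert i.val) := (C.degree_pos_iff_exists_adj _).2 ⟨_, hadj i⟩
        omega
      · exact h
  refine ⟨l, fun i => p.getVert i.val, hl, hinj, hdeg, ?_⟩
  intro i v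
  have ha : C.Adj (p.getVert i.val) (p.getVert (i - 1).val) := by
    have := hadj (i - 1)
    rw [sub_add_cancel] at this
    exact this.symm
  constructor
  · intro hv
    by_contra hcon
    rw [not_or] at hcon
    have h2 := (hdeg (p.getVert i.val)).2 ⟨i, rfl⟩
    rw [← card_neighborFinset_eq_degree] at h2
    have hsub : ({v, p.getVert (i + 1).val, p.getVert (i - 1).val} : Finset V) ⊆
        C.neighborFinset (p.getVert i.val) := by
      intro w hw
      simp only [Finset.mem_insert, Finset.mem_singleton] at hw
      rw [mem_neighborFinset]
      rcases hw with rfl | rfl | rfl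
      · exact hv
      · exact hadj i
      · exact ha
    have hne : p.getVert (i + 1).val ≠ p.getVert (i - 1).val := by
      intro h
      have h := hinj h
      have h3 : i - 1 + ((2 : ℕ) : ZMod l) = i - 1 := by
        have e : i - 1 + ((2 : ℕ) : ZMod l) = i + 1 := by push_cast; ring
        rw [e, h]
      have h4 := hal_val_add (i - 1) 2 (by omega)
      have := ZMod.val_lt (i - 1)
      rw [h3] at h4
      split_ifs at h4 <;> omega
    have := Finset.card_le_card hsub
    rw [Finset.card_eq_three.2 ⟨_, _, _, hcon.1, hcon.2, hne, rfl⟩] at this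
    omega
  · rintro (rfl | rfl)
    · exact hadj i
    · exact ha

/-! ### Rooting the tree -/
theorem hal_root {V : Type*} {T : SimpleGraph V} (hT : T.IsTree) (r0 : V) :
    ∃ (par : V → V) (dep : V → ℕ), HalRoot T r0 par dep := by
  choose q hq using fun v => (hT.existsUnique_path r0 v).exists
  have key : ∀ y u, T.Adj y u → u ∈ (q y).support →
      u = (q y).penultimate ∧ (q y).length = (q u).length + 1 := by
    intro y u h hu
    refine ⟨hT.isAcyclic.eq_penultimate_of_adj_end (hq y) h hu, ?_⟩
    have := hT.isAcyclic.path_concat (hq u) (hq y) h.symm hu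
    rw [this, Walk.length_concat]
  have h0 : (q r0).length = 0 := by
    have := (Walk.isPath_iff_nil).1 (hq r0)
    exact Walk.length_eq_zero_iff.2 this
  have hpa : ∀ v, v ≠ r0 → T.Adj v (q v).penultimate := by
    intro v hv
    exact (Walk.adj_penultimate (Walk.not_nil_of_ne hv.symm)).symm
  refine ⟨fun v => (q v).penultimate, fun v => (q v).length, ⟨?_, ?_⟩⟩
  · intro y u
    constructor
    · intro h
      by_cases hu : u ∈ (q y).support
      · left
        obtain ⟨h1, h2⟩ := key y u h hu
        refine ⟨?_, h1⟩
        rintro rfl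
        omega
      · right
        have hy := hT.isAcyclic.mem_support_of_ne_mem_support_of_adj_of_isPath (hq u) (hq y) h.symm hu
        obtain ⟨h1, h2⟩ := key u y h.symm hy
        refine ⟨?_, h1⟩
        rintro rfl
        omega
    · rintro (⟨h1, rfl⟩ | ⟨h1, rfl⟩)
      · exact hpa y h1
      · exact (hpa u h1).symm
  · intro v hv
    exact (key v _ (hpa v hv) (Walk.getVert_mem_support _ _)).2

/-! ### The system of constraints coming from the cycle -/

theorem hal_cast_ne {l : ℕ} [NeZero l] (k : ℕ) (h1 : 0 < k) (h2 : k < l) : (k : ZMod l) ≠ 0 := by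
  intro h
  have := congrArg ZMod.val h
  rw [ZMod.val_natCast_of_lt h2, ZMod.val_zero] at this
  omega

theorem hal_sys {V : Type*} [Fintype V] (r0 : V) (par : V → V) {l : ℕ} [NeZero l] (hl : 5 ≤ l)
    (w : ZMod l → V) (hw : Function.Injective w) (hw0 : ∀ i, w i ≠ r0) (n N : ℕ) (hn : 12 ≤ n)
    (hCn : ∀ y, (halCh r0 par y).card ≤ n) (L : V → Finset ℕ) (hL : ∀ v, N ≤ (L v).card) :
    ∃ Nb Sp : V → Finset V, HalSys N par Nb Sp L ∧ (∀ i, w (i + 1) ∈ Nb (w i)) ∧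
      (∀ y, Sp y ⊆ halCh r0 par y) ∧
      (∀ y, ((halCh r0 par y).filter (fun x => x ∉ Sp y ∧ (Nb x).Nonempty)).card + 2 ≤ n) ∧
      (∀ y, Sp y ≠ ∅ →
        ((halCh r0 par y).filter (fun x => x ∉ Sp y ∧ (Nb x).Nonempty)).card + 3 ≤ n) := by
  obtain ⟨Nb, hNb⟩ : ∃ Nb : V → Finset V, ∀ v u, u ∈ Nb v ↔
      ∃ i, (v = w i ∧ u = w (i + 1)) ∨ (v = w (i + 1) ∧ u = w i) :=
    ⟨fun v => Finset.univ.filter (fun u => ∃ i, (v = w i ∧ u = w (i + 1)) ∨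
      (v = w (i + 1) ∧ u = w i)), by intro v u; simp⟩
  have hNw : ∀ i u, u ∈ Nb (w i) ↔ u = w (i + 1) ∨ u = w (i - 1) := by
    intro i u
    rw [hNb]
    constructor
    · rintro ⟨j, ⟨h1, h2⟩ | ⟨h1, h2⟩⟩
      · left; rw [hw h1]; exact h2
      · right; rw [hw h1, add_sub_cancel_right]; exact h2
    · rintro (h | h)
      · exact ⟨i, Or.inl ⟨rfl, h⟩⟩
      · exact ⟨i - 1, Or.inr ⟨by rw [sub_add_cancel], h⟩⟩
  have hNv : ∀ v u, u ∈ Nb v → ∃ i, v = w i := by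
    intro v u h
    obtain ⟨i, ⟨h1, h2⟩ | ⟨h1, h2⟩⟩ := (hNb v u).1 h
    · exact ⟨i, h1⟩
    · exact ⟨_, h1⟩
  obtain ⟨I, hI1, hI2⟩ := hal_select (by omega : 4 ≤ l) (fun i => par (w i))
  obtain ⟨K, hK⟩ : ∃ K : V → Finset (ZMod l), K = fun y => Finset.univ.filter (fun i => par (w i) = y) :=
    ⟨_, rfl⟩
  have mK : ∀ y i, i ∈ K y ↔ par (w i) = y := by intro y i; rw [hK]; simp
  have hKn : ∀ y, (K y).card ≤ n := by
    intro y
    refine le_trans ?_ (hCn y)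
    rw [← Finset.card_image_of_injective _ hw]
    apply Finset.card_le_card
    intro v hv
    obtain ⟨i, hi, rfl⟩ := Finset.mem_image.1 hv
    exact mem_halCh.2 ⟨hw0 i, (mK y i).1 hi⟩
  have hs : ∀ y, ∃ s : Finset (ZMod l), s ⊆ I ∧ s ⊆ K y ∧ s.card ≤ 3 ∧
      (K y \ s).card + 2 ≤ n ∧ (s ≠ ∅ → (K y \ s).card + 3 ≤ n) := by
    intro y
    have e1 := hI2 y
    have e2 := hKn y
    have e3 : Finset.univ.filter (fun i => par (w i) = y) = K y := by rw [hK]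
    rw [e3] at e1
    have pick : ∀ m, m ≤ 3 → m ≤ (I.filter (fun i => par (w i) = y)).card →
        (K y).card + 3 ≤ n + m → ∃ s : Finset (ZMod l), s ⊆ I ∧ s ⊆ K y ∧ s.card ≤ 3 ∧
      (K y \ s).card + 2 ≤ n ∧ (s ≠ ∅ → (K y \ s).card + 3 ≤ n) := by
      intro m hm3 hm hk
      obtain ⟨s, hs1, hs2⟩ := Finset.exists_subset_card_eq hm
      have hsK : s ⊆ K y := fun i hi => (mK y i).2 (Finset.mem_filter.1 (hs1 hi)).2
      have := Finset.card_sdiff_add_card_eq_card hsK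
      exact ⟨s, fun i hi => (Finset.mem_filter.1 (hs1 hi)).1, hsK, by omega, by omega,
        fun _ => by omega⟩
    by_cases c1 : (K y).card = n
    · exact pick 3 le_rfl (by omega) (by omega)
    · by_cases c2 : (K y).card + 1 = n
      · exact pick 2 (by omega) (by omega) (by omega)
      · exact ⟨∅, by simp, by simp, by simp, by simp; omega, fun h => absurd rfl h⟩
  choose s s1 s2 s3 s4 s5 using hs
  have hcount : ∀ y, ((halCh r0 par y).filter
      (fun x => x ∉ (s y).image w ∧ (Nb x).Nonempty)).card ≤ (K y \ s y).card := by
    intro y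
    rw [← Finset.card_image_of_injective _ hw]
    apply Finset.card_le_card
    intro v hv
    obtain ⟨hv1, hv2, u, hu⟩ := Finset.mem_filter.1 hv
    obtain ⟨i, rfl⟩ := hNv v u hu
    refine Finset.mem_image_of_mem _ (Finset.mem_sdiff.2 ⟨(mK y i).2 (mem_halCh.1 hv1).2, ?_⟩)
    intro hi
    exact hv2 (Finset.mem_image_of_mem _ hi)
  have hNsymm : ∀ x z, z ∈ Nb x → x ∈ Nb z := by
    intro x z h
    rw [hNb] at h ⊢
    obtain ⟨i, h | h⟩ := h
    · exact ⟨i, Or.inr ⟨h.2, h.1⟩⟩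
    · exact ⟨i, Or.inl ⟨h.2, h.1⟩⟩
  refine ⟨Nb, fun y => (s y).image w, ⟨hNsymm, ?_, ?_, ?_, ?_, ?_, hL⟩, ?_, ?_, ?_, ?_⟩
  · intro x
    by_cases h : ∃ u, u ∈ Nb x
    · obtain ⟨u, hu⟩ := h
      obtain ⟨i, rfl⟩ := hNv x u hu
      have : Nb (w i) ⊆ {w (i + 1), w (i - 1)} := by
        intro u hu
        simpa using (hNw i u).1 hu
      exact (Finset.card_le_card this).trans Finset.card_le_two
    · push Not at h
      rw [Finset.eq_empty_of_forall_notMem h]; simp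
  · intro x x' z z' hx hz h1 h2 h3 h4
    obtain ⟨i, rfl⟩ := hNv x z h1
    obtain ⟨j, rfl⟩ := hNv x' z h3
    have hij : i ≠ j := fun h => hx (by rw [h])
    rw [hNw] at h1 h2 h3 h4
    have two : ((2 : ℕ) : ZMod l) ≠ 0 := hal_cast_ne 2 (by omega) (by omega)
    have four : ((4 : ℕ) : ZMod l) ≠ 0 := hal_cast_ne 4 (by omega) (by omega)
    push_cast at two four
    have A : ∀ a b, z = w a → z = w b → a = b := fun a b h h' => hw (h.symm.trans h')
    have B : ∀ a b, z' = w a → z' = w b → a = b := fun a b h h' => hw (h.symm.trans h')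
    have fin : i + 1 = j - 1 → i - 1 = j + 1 → False := by
      intro e1 e2
      apply four
      linear_combination e1 - e2
    rcases h1 with h1 | h1 <;> rcases h3 with h3 | h3
    · exact hij (add_right_cancel (A _ _ h1 h3))
    · rcases h2 with h2 | h2
      · exact hz (h1.trans h2.symm)
      · rcases h4 with h4 | h4
        · exact fin (A _ _ h1 h3) (B _ _ h2 h4)
        · exact hz (h3.trans h4.symm)
    · rcases h2 with h2 | h2
      · rcases h4 with h4 | h4
        · exact hz (h3.trans h4.symm)
        · exact fin (B _ _ h2 h4) (A _ _ h1 h3)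
      · exact hz (h1.trans h2.symm)
    · exact hij (sub_left_injective (A _ _ h1 h3))
  · intro y z hz
    obtain ⟨i, hi, rfl⟩ := Finset.mem_image.1 hz
    exact (mK y i).1 (s2 y hi)
  · intro y; exact Finset.card_image_le.trans (s3 y)
  · intro y y' z hz z' hz' hn
    obtain ⟨i, hi, rfl⟩ := Finset.mem_image.1 hz
    obtain ⟨j, hj, rfl⟩ := Finset.mem_image.1 hz'
    rcases (hNw _ _).1 hn with h | h
    · have := hw h
      rw [this] at hj
      exact hI1 i (s1 y hi) (s1 y' hj)
    · have := hw h
      apply hI1 j (s1 y' hj)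
      rw [this, sub_add_cancel]; exact s1 y hi
  · intro i; exact (hNw _ _).2 (Or.inl rfl)
  · intro y v hv
    obtain ⟨i, hi, rfl⟩ := Finset.mem_image.1 hv
    exact mem_halCh.2 ⟨hw0 i, (mK y i).1 (s2 y hi)⟩
  · intro y
    exact (Nat.add_le_add_right (hcount y) 2).trans (s4 y)
  · intro y hne
    refine (Nat.add_le_add_right (hcount y) 3).trans (s5 y ?_)
    intro h
    exact hne (by simp [h])

/-! ### Checking star colourings -/

theorem hal_star_check {V : Type*} (G : SimpleGraph V) (φ : Sym2 V → ℕ)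
    (h1 : ∀ a b d, G.Adj a b → G.Adj b d → a ≠ d → φ s(a, b) ≠ φ s(b, d))
    (h2 : ∀ a b c d f, G.Adj a b → G.Adj b c → G.Adj c d → G.Adj d f → a ≠ c → b ≠ d → c ≠ f →
      φ s(a, b) = φ s(c, d) → φ s(b, c) = φ s(d, f) → False) : IsStarEdgeColoring G φ := by
  have key : ∀ a b c d f, G.Adj a b → G.Adj b c → G.Adj c d → G.Adj d f → a ≠ c → b ≠ d → c ≠ f →
      (∃ c₁ c₂ : ℕ, ∀ e ∈ [s(a, b), s(b, c), s(c, d), s(d, f)], φ e = c₁ ∨ φ e = c₂) → False := by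
    rintro a b c d f e1 e2 e3 e4 n1 n2 n3 ⟨c₁, c₂, h⟩
    have p1 := h1 a b c e1 e2 n1
    have p2 := h1 b c d e2 e3 n2
    have p3 := h1 c d f e3 e4 n3
    have q1 := h s(a, b) (by simp)
    have q2 := h s(b, c) (by simp)
    have q3 := h s(c, d) (by simp)
    have q4 := h s(d, f) (by simp)
    apply h2 a b c d f e1 e2 e3 e4 n1 n2 n3 <;> omega
  refine ⟨?_, ?_, ?_⟩
  · rintro e₁ he₁ e₂ he₂ ⟨hne, v, hv1, hv2⟩
    obtain ⟨a, rfl⟩ := Sym2.mem_iff_exists.1 hv1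
    obtain ⟨b, rfl⟩ := Sym2.mem_iff_exists.1 hv2
    rw [mem_edgeSet] at he₁ he₂
    rw [Sym2.eq_swap]
    exact h1 a v b he₁.symm he₂ (by rintro rfl; exact hne rfl)
  · intro u v p hp hl
    match p, hl with
    | .cons e1 (.cons e2 (.cons e3 (.cons e4 .nil))), _ =>
      simp only [Walk.isPath_def, Walk.support_cons, Walk.support_nil, List.nodup_cons,
        List.mem_cons, not_or, List.not_mem_nil] at hp
      intro h
      refine key _ _ _ _ _ e1 e2 e3 e4 ?_ ?_ ?_ (by simpa using h) <;> tauto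
  · intro u p hp hl
    match p, hl with
    | .cons e1 (.cons e2 (.cons e3 (.cons e4 .nil))), _ =>
      have hp := hp.support_nodup
      simp only [Walk.support_cons, Walk.support_nil, List.tail_cons, List.nodup_cons,
        List.mem_cons, not_or, List.not_mem_nil] at hp
      intro h
      refine key _ _ _ _ _ e1 e2 e3 e4 ?_ ?_ ?_ (by simpa using h)
      · exact fun h => hp.2.1.2.1 h.symm
      · tauto
      · tauto

theorem hal_assemble {V : Type*} (T C : SimpleGraph V) (φ : Sym2 V → ℕ) (R : V → V → V → Prop)
    (F1 : ∀ a b y, C.Adj a b → T.Adj a y → φ s(a, b) ≠ φ s(a, y))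
    (F2 : ∀ a b d y, C.Adj a b → C.Adj b d → a ≠ d → T.Adj d y → φ s(a, b) ≠ φ s(d, y))
    (F3 : ∀ a b y u, C.Adj a b → T.Adj a y → T.Adj y u → R y u a → φ s(a, b) ≠ φ s(y, u))
    (F4 : ∀ a b y z, C.Adj a b → T.Adj a y → T.Adj b z → φ s(a, y) ≠ φ s(b, z))
    (F5 : ∀ a b d, C.Adj a b → C.Adj b d → a ≠ d → φ s(a, b) ≠ φ s(b, d))
    (F6 : ∀ a b c d f, C.Adj a b → C.Adj b c → C.Adj c d → C.Adj d f → a ≠ c → b ≠ d → c ≠ f →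
      φ s(a, b) = φ s(c, d) → φ s(b, c) = φ s(d, f) → False)
    (F8 : ∀ a b u v, T.Adj a b → C.Adj a u → C.Adj b v → False)
    (T1 : ∀ a b d, T.Adj a b → T.Adj b d → a ≠ d → φ s(a, b) ≠ φ s(b, d))
    (T2 : ∀ a b c d f, T.Adj a b → T.Adj b c → T.Adj c d → T.Adj d f → a ≠ c → b ≠ d → c ≠ f →
      φ s(a, b) = φ s(c, d) → φ s(b, c) = φ s(d, f) → False)
    (T3 : ∀ x y v u, T.Adj y x → T.Adj y v → T.Adj v u → x ≠ v → y ≠ u →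
      φ s(v, u) = φ s(y, x) → R y v x)
    (tot : ∀ y u v, T.Adj y u → T.Adj y v → u ≠ v → R y u v ∨ R y v u) :
    IsStarEdgeColoring (T ⊔ C) φ := by
  have sw : ∀ a b : V, φ s(a, b) = φ s(b, a) := fun a b => by rw [Sym2.eq_swap]
  apply hal_star_check
  · intro a b d h1 h2 hne
    rw [sup_adj] at h1 h2
    rcases h1 with h1 | h1 <;> rcases h2 with h2 | h2
    · exact T1 a b d h1 h2 hne
    · rw [sw a b]; exact (F1 b d a h2 h1.symm).symm
    · rw [sw a b]; exact F1 b a d h1.symm h2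
    · exact F5 a b d h1 h2 hne
  · intro a b c d f h1 h2 h3 h4 n1 n2 n3 e1 e2
    rw [sup_adj] at h1 h2 h3 h4
    rcases h1 with h1 | h1 <;> rcases h2 with h2 | h2 <;> rcases h3 with h3 | h3 <;>
      rcases h4 with h4 | h4
    · exact T2 a b c d f h1 h2 h3 h4 n1 n2 n3 e1 e2
    · -- TTTC
      have := T3 d c b a h3 h2.symm h1.symm n2.symm n1.symm (by rw [sw b a]; exact e1)
      exact F3 d f c b h4 h3.symm h2.symm this (by rw [← e2, sw b c])
    · -- TTCT
      exact F4 c d b f h3 h2.symm h4 (by rw [sw c b]; exact e2)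
    · -- TTCC
      exact F2 f d c b h4.symm h3.symm n3.symm h2.symm (by rw [sw f d, sw c b]; exact e2.symm)
    · -- TCTT
      exact F4 b c a d h2 h1.symm h3 (by rw [sw b a]; exact e1)
    · -- TCTC
      exact F8 c d b f h3 h2.symm h4
    · -- TCCT
      exact F2 b c d f h2 h3 n2 h4 e2
    · -- TCCC
      exact F2 d c b a h3.symm h2.symm n2.symm h1.symm (by rw [sw d c, sw b a]; exact e1.symm)
    · -- CTTT
      have := T3 b c d f h2.symm h3 h4 n2 n3 (by rw [sw c b]; exact e2.symm)
      exact F3 b a c d h1.symm h2 h3 this (by rw [sw b a]; exact e1)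
    · -- CTTC
      rcases tot c b d h2.symm h3 n2 with h | h
      · exact F3 d f c b h4 h3.symm h2.symm h (by rw [sw c b]; exact e2.symm)
      · exact F3 b a c d h1.symm h2 h3 h (by rw [sw b a]; exact e1)
    · exact F8 b c a d h2 h1.symm h3
    · exact F8 b c a d h2 h1.symm h3
    · -- CCTT
      exact F2 a b c d h1 h2 n1 h3 e1
    · exact F8 c d b f h3 h2.symm h4
    · -- CCCT
      exact F2 b c d f h2 h3 n2 h4 e2
    · exact F6 a b c d f h1 h2 h3 h4 n1 n2 n3 e1 e2

/-! ### Properties of the tree colouring -/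
section
variable {V : Type*} [Fintype V] {T : SimpleGraph V} {r0 : V} {par : V → V} {dep : V → ℕ}

theorem HalRoot.phi (hr : HalRoot T r0 par dep) {c : V → ℕ} {φ : Sym2 V → ℕ}
    (hφ : ∀ v, v ≠ r0 → φ s(v, par v) = c v) {p u : V} (h : T.Adj p u) :
    φ s(p, u) = halCol r0 par c p u := by
  rcases (hr.adj _ _).1 h with ⟨h1, rfl⟩ | ⟨h1, rfl⟩
  · rw [halCol, if_pos ⟨h1, rfl⟩, hφ p h1]
  · rw [hr.col_child c h1, Sym2.eq_swap, hφ u h1]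

theorem HalRoot.T3a (hr : HalRoot T r0 par dep) {c : V → ℕ} {φ : Sym2 V → ℕ} {D : ℕ}
    {R : V → V → V → Prop} (hφ : ∀ v, v ≠ r0 → φ s(v, par v) = c v)
    (hQ : ∀ y, HalQ T r0 par D c R y) {x y v u : V} (hv : v ≠ r0) (hvy : par v = y)
    (hx : T.Adj y x) (hu : T.Adj v u) (huy : y ≠ u) (he : φ s(v, u) = φ s(y, x)) : ¬ R y x v := by
  intro hR
  rcases (hr.adj _ _).1 hu with ⟨h1, h2⟩ | ⟨h1, h2⟩
  · exact huy (by rw [h2, hvy])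
  · subst hvy
    apply (hQ v).av hv u h1 h2.symm x hx hR
    rw [← hr.phi hφ hx, ← he, h2, Sym2.eq_swap, hφ u h1]

theorem HalRoot.T3b (hr : HalRoot T r0 par dep) {c : V → ℕ} {φ : Sym2 V → ℕ} {D : ℕ}
    {R : V → V → V → Prop} (hφ : ∀ v, v ≠ r0 → φ s(v, par v) = c v)
    (hQ : ∀ y, HalQ T r0 par D c R y) {x y u : V} (hy : y ≠ r0) (hx : x ≠ r0) (hxy : par x = y)
    (hu : T.Adj (par y) u) (he : φ s(par y, u) = φ s(y, x)) : R y (par y) x := by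
  apply (hQ y).up hy x hx hxy u hu
  rw [← hr.phi hφ hu, he, ← hxy, Sym2.eq_swap, hφ x hx]

theorem HalRoot.T3 (hr : HalRoot T r0 par dep) {c : V → ℕ} {φ : Sym2 V → ℕ} {D : ℕ}
    {R : V → V → V → Prop} (hφ : ∀ v, v ≠ r0 → φ s(v, par v) = c v)
    (hQ : ∀ y, HalQ T r0 par D c R y) (x y v u : V) (hx : T.Adj y x) (hv : T.Adj y v)
    (hu : T.Adj v u) (hxv : x ≠ v) (hyu : y ≠ u) (he : φ s(v, u) = φ s(y, x)) : R y v x := by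
  rcases (hr.adj _ _).1 hv with ⟨h1, h2⟩ | ⟨h1, h2⟩
  · rcases (hr.adj _ _).1 hx with ⟨h3, h4⟩ | ⟨h3, h4⟩
    · exact absurd (h4.trans h2.symm) hxv
    · subst h2
      exact hr.T3b hφ hQ h1 h3 h4.symm hu he
  · have := hr.T3a hφ hQ h1 h2.symm hx hu hyu he
    have := (hQ y).tot x v hx hv hxv
    tauto

theorem HalRoot.T1 (hr : HalRoot T r0 par dep) {c : V → ℕ} {φ : Sym2 V → ℕ} {D : ℕ}
    {R : V → V → V → Prop} (hφ : ∀ v, v ≠ r0 → φ s(v, par v) = c v)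
    (hQ : ∀ y, HalQ T r0 par D c R y) (a b d : V) (h1 : T.Adj a b) (h2 : T.Adj b d) (hne : a ≠ d) :
    φ s(a, b) ≠ φ s(b, d) := by
  rcases (hr.adj _ _).1 h1 with ⟨p1, p2⟩ | ⟨p1, p2⟩ <;>
    rcases (hr.adj _ _).1 h2 with ⟨q1, q2⟩ | ⟨q1, q2⟩
  · rw [q2, hφ b q1, p2, hφ a p1]
    rw [p2] at q1
    exact (hQ _).ne q1 a p1 rfl
  · rw [Sym2.eq_swap (a := b), q2, hφ d q1, ← q2, p2, hφ a p1]
    intro h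
    exact hne ((hQ b).inj a p1 p2.symm d q1 q2.symm h)
  · exact absurd (p2.trans q2.symm) hne
  · rw [Sym2.eq_swap (a := b), q2, hφ d q1, ← q2, Sym2.eq_swap, p2, hφ b p1]
    exact ((hQ b).ne p1 d q1 q2.symm).symm

theorem HalRoot.T2 (hr : HalRoot T r0 par dep) {c : V → ℕ} {φ : Sym2 V → ℕ} {D : ℕ}
    {R : V → V → V → Prop} (hφ : ∀ v, v ≠ r0 → φ s(v, par v) = c v)
    (hQ : ∀ y, HalQ T r0 par D c R y) (a b m d f : V) (h1 : T.Adj a b) (h2 : T.Adj b m)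
    (h3 : T.Adj m d) (h4 : T.Adj d f) (n1 : a ≠ m) (n2 : b ≠ d) (n3 : m ≠ f)
    (e1 : φ s(a, b) = φ s(m, d)) (e2 : φ s(b, m) = φ s(d, f)) : False := by
  have e1' : φ s(b, a) = φ s(m, d) := by rw [Sym2.eq_swap]; exact e1
  have e2' : φ s(d, f) = φ s(m, b) := by rw [Sym2.eq_swap (a := m)]; exact e2.symm
  rcases (hr.adj _ _).1 h2 with ⟨p1, p2⟩ | ⟨p1, p2⟩
  · have k1 := hr.T3a hφ hQ p1 p2.symm h3 h1.symm n1.symm e1'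
    rcases (hr.adj _ _).1 h3 with ⟨q1, q2⟩ | ⟨q1, q2⟩
    · subst q2
      exact k1 (hr.T3b hφ hQ q1 p1 p2.symm h4 e2')
    · have k2 := hr.T3a hφ hQ q1 q2.symm h2.symm h4 n3 e2'
      have := (hQ m).tot b d h2.symm h3 n2
      tauto
  · rcases (hr.adj _ _).1 h3 with ⟨q1, q2⟩ | ⟨q1, q2⟩
    · exact n2 (p2.trans q2.symm)
    · have k2 := hr.T3a hφ hQ q1 q2.symm h2.symm h4 n3 e2'
      subst p2
      exact k2 (hr.T3b hφ hQ p1 q1 q2.symm h1.symm e1')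

end

/-! ### Degrees -/
theorem hal_degrees {V : Type*} [Fintype V] {H T C : SimpleGraph V} (h : IsGenHalin H T C)
    (hΔ : 13 ≤ H.maxDegree) : (∀ v, T.degree v ≤ H.maxDegree) ∧ (∃ v, T.degree v = H.maxDegree) ∧
      13 ≤ (Finset.univ.filter (fun v => T.degree v = 1)).card := by
  obtain ⟨hT, -, hH, -, h1, h2, -⟩ := h
  have hle : ∀ v, T.degree v ≤ H.degree v := by
    intro v
    rw [← card_neighborFinset_eq_degree, ← card_neighborFinset_eq_degree]
    apply Finset.card_le_card
    intro u hu
    rw [mem_neighborFinset] at hu ⊢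
    rw [hH, sup_adj]; exact Or.inl hu
  have hle2 : ∀ v, H.degree v ≤ T.degree v + C.degree v := by
    intro v
    rw [← card_neighborFinset_eq_degree, ← card_neighborFinset_eq_degree,
      ← card_neighborFinset_eq_degree]
    refine le_trans (Finset.card_le_card ?_) (Finset.card_union_le _ _)
    intro u hu
    rw [mem_neighborFinset, hH, sup_adj] at hu
    rw [Finset.mem_union, mem_neighborFinset, mem_neighborFinset]; exact hu
  have hmax : ∀ v, T.degree v ≤ H.maxDegree := fun v => (hle v).trans (H.degree_le_maxDegree v)
  have := hT.connected.nonempty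
  obtain ⟨v, hv⟩ := H.exists_maximal_degree_vertex
  have hTv : T.degree v = H.maxDegree := by
    have e1 := hle2 v
    have e2 := hmax v
    rcases h2 v with e | e
    · omega
    · have := (h1 v).2 e
      omega
  refine ⟨hmax, ⟨v, hTv⟩, ?_⟩
  have hsum := T.sum_degrees_eq_twice_card_edges
  have hcard := hT.card_edgeFinset
  have hpos : ∀ u, 1 ≤ T.degree u := by
    obtain ⟨u', hu'⟩ := (T.degree_pos_iff_exists_adj v).1 (by omega)
    have : Nontrivial V := ⟨⟨v, u', hu'.ne⟩⟩
    intro u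
    exact hT.connected.preconnected.degree_pos_of_nontrivial u
  have hlow : ∑ u, (2 + if u = v then 11 else 0) ≤
      ∑ u, (T.degree u + if T.degree u = 1 then 1 else 0) := by
    apply Finset.sum_le_sum
    intro u _
    have := hpos u
    by_cases hu : u = v
    · subst hu
      rw [if_pos rfl]; omega
    · rw [if_neg hu]
      split_ifs <;> omega
  rw [Finset.sum_add_distrib, Finset.sum_add_distrib, Finset.sum_ite_eq' Finset.univ v,
    ← Finset.card_filter] at hlow
  simp only [Finset.sum_const, Finset.card_univ, smul_eq_mul, Finset.mem_univ, if_true] at hlow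
  have hcard' : T.edgeFinset.card + 1 = Fintype.card V := by
    rw [← hcard]
  omega

/-! ### The upper bound -/

theorem hal_two_leaves {V : Type*} [Fintype V] {T : SimpleGraph V} (hT : T.IsTree) {a b : V}
    (hab : T.Adj a b) (ha : ∀ u, T.Adj a u → u = b) (hb : ∀ u, T.Adj b u → u = a) :
    ∀ v, v = a ∨ v = b := by
  obtain ⟨par, dep, hr⟩ := hal_root hT a
  have : ∀ m v, dep v = m → v = a ∨ v = b := by
    intro m
    induction m with
    | zero =>
      intro v hv
      by_contra hc
      rw [not_or] at hc
      have := hr.dep v hc.1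
      omega
    | succ m ih =>
      intro v hv
      by_cases h : v = a
      · exact Or.inl h
      · have h1 := hr.dep v h
        have h2 := hr.adj_par h
        rcases ih (par v) (by omega) with h3 | h3
        · right; apply ha; rw [← h3]; exact h2
        · left; apply hb; rw [← h3]; exact h2
  exact fun v => this _ v rfl

theorem hal_upper {V : Type*} [Fintype V] {H T C : SimpleGraph V} (h : IsGenHalin H T C)
    (hΔ : 13 ≤ H.maxDegree) : StarChoosable H (3 * H.maxDegree / 2) := by
  intro L hL
  obtain ⟨hmax, ⟨vm, hvm⟩, hleaves⟩ := hal_degrees h hΔ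
  obtain ⟨hT, -, hH, hdisj, h1, h2, h3⟩ := h
  obtain ⟨Δ, hΔe⟩ : ∃ Δ, Δ = H.maxDegree := ⟨_, rfl⟩
  rw [← hΔe] at hΔ hL hmax hvm
  obtain ⟨v0, hv0⟩ := Finset.card_pos.1 (by omega : 0 < (Finset.univ.filter (fun v => T.degree v = 1)).card)
  have hv0 := (Finset.mem_filter.1 hv0).2
  obtain ⟨l, x, hl3, hx, hxd, hxadj⟩ := hal_cycle_index C v0 ((h1 v0).1 hv0) h2 h3
  have : NeZero l := ⟨by omega⟩
  have hl : 13 ≤ l := by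
    have e : Finset.univ.filter (fun v => T.degree v = 1) = Finset.univ.image x := by
      ext v
      simp only [Finset.mem_filter, Finset.mem_univ, true_and, Finset.mem_image]
      rw [h1, hxd]
    rw [e, Finset.card_image_of_injective _ hx, Finset.card_univ, ZMod.card] at hleaves
    exact hleaves
  have hleaf : ∀ i u v, T.Adj (x i) u → T.Adj (x i) v → u = v := by
    intro i u v hu hv
    have := (h1 (x i)).2 ((hxd _).2 ⟨i, rfl⟩)
    exact (degree_eq_one_iff_existsUnique_adj.1 this).unique hu hv
  have htn : ∀ i, ∃ y, T.Adj (x i) y := by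
    intro i
    have := (h1 (x i)).2 ((hxd _).2 ⟨i, rfl⟩)
    exact (degree_eq_one_iff_existsUnique_adj.1 this).exists
  choose tn htn using htn
  have hnon : ∀ i j, ¬ T.Adj (x i) (x j) := by
    intro i j hij
    have hall := hal_two_leaves hT hij (fun u hu => hleaf i _ _ hu hij)
      (fun u hu => hleaf j _ _ hu hij.symm)
    have k1 : ∀ i, T.degree (x i) = 1 := fun i => (h1 (x i)).2 ((hxd _).2 ⟨i, rfl⟩)
    rcases hall vm with e | e
    · rw [e, k1] at hvm; omega
    · rw [e, k1] at hvm; omega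
  obtain ⟨r0, hr0⟩ : ∃ r0, r0 = x 0 := ⟨_, rfl⟩
  obtain ⟨par, dep, hr⟩ := hal_root hT r0
  have hpar0 : tn 0 ≠ r0 ∧ par (tn 0) = r0 := by
    have := htn 0
    rw [← hr0, hr.adj] at this
    rcases this with h | h
    · exact absurd rfl h.1
    · exact ⟨h.1, h.2.symm⟩
  obtain ⟨w, hwdef⟩ : ∃ w : ZMod l → V, w = fun i => if i = 0 then tn 0 else x i := ⟨_, rfl⟩
  have w0 : w 0 = tn 0 := by rw [hwdef]; simp
  have w1 : ∀ i, i ≠ 0 → w i = x i := by intro i hi; rw [hwdef]; simp [hi]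
  have hxr : ∀ i, i ≠ 0 → x i ≠ r0 := by
    intro i hi h; rw [hr0] at h; exact hi (hx h)
  have htx : ∀ i, tn 0 ≠ x i := by
    intro i h
    have := htn 0
    rw [h] at this
    exact hnon _ _ this
  have hw0 : ∀ i, w i ≠ r0 := by
    intro i
    by_cases hi : i = 0
    · rw [hi, w0]; exact hpar0.1
    · rw [w1 i hi]; exact hxr i hi
  have hw : Function.Injective w := by
    intro i j hij
    by_cases hi : i = 0 <;> by_cases hj : j = 0
    · rw [hi, hj]
    · rw [hi, w0, w1 j hj] at hij; exact absurd hij (htx j)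
    · rw [hj, w0, w1 i hi] at hij; exact absurd hij.symm (htx i)
    · rw [w1 i hi, w1 j hj] at hij; exact hx hij
  have hwe : ∀ i, s(w i, par (w i)) = s(x i, tn i) := by
    intro i
    by_cases hi : i = 0
    · rw [hi, w0, hpar0.2, hr0, Sym2.eq_swap]
    · rw [w1 i hi]
      rw [hleaf i (tn i) (par (x i)) (htn i) (hr.adj_par (hxr i hi)).symm]
  obtain ⟨L', hL'⟩ : ∃ L' : V → Finset ℕ, L' = fun v => if v = r0 then Finset.range (3 * Δ / 2) else
    L s(v, par v) := ⟨_, rfl⟩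
  have hTH : ∀ u v, T.Adj u v → H.Adj u v := by
    intro u v huv; rw [hH, sup_adj]; exact Or.inl huv
  have hCH : ∀ u v, C.Adj u v → H.Adj u v := by
    intro u v huv; rw [hH, sup_adj]; exact Or.inr huv
  have hL'c : ∀ v, 3 * Δ / 2 ≤ (L' v).card := by
    intro v
    rw [hL']
    by_cases hv : v = r0
    · simp [hv]
    · simp only [hv, if_false]
      exact hL _ (hTH _ _ (hr.adj_par hv).symm)
  have hdegf : ∀ y, (Finset.univ.filter (fun u => T.Adj y u)).card = T.degree y := by
    intro y
    rw [← card_neighborFinset_eq_degree, neighborFinset_eq_filter]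
  have hCn : ∀ y, (halCh r0 par y).card ≤ Δ - 1 := by
    intro y
    by_cases hy : y = r0
    · have : halCh r0 par y ⊆ {tn 0} := by
        intro v hv
        rw [mem_halCh] at hv
        rw [Finset.mem_singleton]
        apply hleaf 0 _ _ _ (htn 0)
        rw [← hr0, ← hy, ← hv.2]
        exact hr.adj_par hv.1
      have := Finset.card_le_card this
      rw [Finset.card_singleton] at this
      omega
    · have hsub : insert (par y) (halCh r0 par y) ⊆ T.neighborFinset y := by
        intro v hv
        rw [mem_neighborFinset]
        rcases Finset.mem_insert.1 hv with rfl | hv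
        · exact (hr.adj_par hy).symm
        · rw [mem_halCh] at hv
          rw [← hv.2]; exact hr.adj_par hv.1
      have hni : par y ∉ halCh r0 par y := by
        intro hv
        rw [mem_halCh] at hv
        exact hr.par_par_ne hy hv.1 hv.2
      have := Finset.card_le_card hsub
      rw [Finset.card_insert_of_notMem hni, card_neighborFinset_eq_degree] at this
      have := hmax y
      omega
  obtain ⟨Nb, Sp, hs, hNb, hSp, g1, g2⟩ := hal_sys r0 par (by omega : 5 ≤ l) w hw hw0 (Δ - 1)
    (3 * Δ / 2) (by omega) hCn L' hL'c
  obtain ⟨c, R, c1, c2, hQ⟩ := hal_topdown hr hs (Δ / 2) (Δ - 1)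
    (by
      intro y _
      rw [hdegf]
      have := hmax y
      omega)
    (by intro u v hu hv; rw [hr0] at hu hv; exact hleaf 0 u v hu hv)
    (by omega) hCn hSp g1 g2
  have one : (1 : ZMod l) ≠ 0 := by
    have := hal_cast_ne (l := l) 1 (by omega) (by omega)
    rwa [Nat.cast_one] at this
  have two : (2 : ZMod l) ≠ 0 := by
    have := hal_cast_ne (l := l) 2 (by omega) (by omega)
    rwa [Nat.cast_two] at this
  -- colours of pendant edges
  obtain ⟨tc, htc⟩ : ∃ tc : ZMod l → ℕ, tc = fun i => c (w i) := ⟨_, rfl⟩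
  have htcne : ∀ i, tc i ≠ tc (i + 1) := by
    intro i
    rw [htc]
    by_cases hp : par (w i) = par (w (i + 1))
    · intro hc
      have := hw ((hQ _).inj (w i) (hw0 i) rfl (w (i + 1)) (hw0 _) hp.symm hc)
      apply one
      linear_combination -this
    · exact c2 _ _ (hw0 _) (hw0 _) (hNb i) hp
  obtain ⟨A, hA⟩ : ∃ A : ZMod l → Finset ℕ, A = fun i => (Finset.univ.filter
    (fun u => T.Adj (tn i) u ∧ R (tn i) u (x i))).image (halCol r0 par c (tn i)) := ⟨_, rfl⟩
  have hAc : ∀ i, (A i).card ≤ Δ / 2 := by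
    intro i
    rw [hA]
    exact Finset.card_image_le.trans ((hQ (tn i)).inD (x i) (htn i).symm)
  obtain ⟨e, e1, e2, e3⟩ := hal_cycle_list (by omega : 8 ≤ l) (fun i => L s(x i, x (i + 1)) \
    ({tc (i - 1), tc i, tc (i + 1), tc (i + 2)} ∪ (A i ∪ A (i + 1)))) (by
      intro i
      have k1 := Finset.le_card_sdiff ({tc (i - 1), tc i, tc (i + 1), tc (i + 2)} ∪ (A i ∪ A (i + 1)))
        (L s(x i, x (i + 1)))
      have k2 := Finset.card_union_le {tc (i - 1), tc i, tc (i + 1), tc (i + 2)} (A i ∪ A (i + 1))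
      have k3 := Finset.card_union_le (A i) (A (i + 1))
      have k4 := hAc i
      have k5 := hAc (i + 1)
      have k6 : ({tc (i - 1), tc i, tc (i + 1), tc (i + 2)} : Finset ℕ).card ≤ 4 := Finset.card_le_four
      have k7 := hL s(x i, x (i + 1)) (hCH _ _ ((hxadj i _).2 (Or.inl rfl)))
      omega)
  have eL : ∀ i, e i ∈ L s(x i, x (i + 1)) := fun i => (Finset.mem_sdiff.1 (e1 i)).1
  have en : ∀ i, (e i ≠ tc (i - 1) ∧ e i ≠ tc i ∧ e i ≠ tc (i + 1) ∧ e i ≠ tc (i + 2)) ∧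
      e i ∉ A i ∧ e i ∉ A (i + 1) := by
    intro i
    have := (Finset.mem_sdiff.1 (e1 i)).2
    simpa only [Finset.mem_union, Finset.mem_insert, Finset.mem_singleton, not_or] using this
  -- the colouring
  obtain ⟨f, hf⟩ : ∃ f : {v : V // v ≠ r0} ⊕ ZMod l → Sym2 V,
    f = Sum.elim (fun v => s(v.1, par v.1)) (fun i => s(x i, x (i + 1))) := ⟨_, rfl⟩
  have hfC : ∀ i, s(x i, x (i + 1)) ∈ C.edgeSet := fun i => (hxadj i _).2 (Or.inl rfl)
  have hfT : ∀ v, v ≠ r0 → s(v, par v) ∈ T.edgeSet := fun v hv => (hr.adj_par hv).symm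
  have hfinj : Function.Injective f := by
    rw [hf]
    apply Function.Injective.sumElim
    · rintro ⟨u, hu⟩ ⟨v, hv⟩ huv
      simp only [Sym2.eq_iff] at huv
      rcases huv with huv | huv
      · exact Subtype.ext huv.1
      · exfalso
        have k1 := hr.dep u hu
        have k2 := hr.dep v hv
        rw [huv.2] at k1
        rw [← huv.1] at k2
        omega
    · intro i j hij
      simp only [Sym2.eq_iff] at hij
      rcases hij with hij | hij
      · exact hx hij.1
      · exfalso
        have k1 := hx hij.1
        have k2 := hx hij.2
        apply two
        linear_combination k2 - k1
    · rintro ⟨u, hu⟩ i hui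
      have k1 := hfT u hu
      simp only at hui
      rw [hui] at k1
      exact Set.disjoint_left.1 hdisj k1 (hfC i)
  obtain ⟨φ, hφ⟩ : ∃ φ : Sym2 V → ℕ, φ = Function.extend f (Sum.elim (fun v => c v.1) e) 0 := ⟨_, rfl⟩
  have φT : ∀ v, v ≠ r0 → φ s(v, par v) = c v := by
    intro v hv
    have := hfinj.extend_apply (Sum.elim (fun v => c v.1) e) 0 (Sum.inl ⟨v, hv⟩)
    rw [← hφ, hf] at this
    exact this
  have φC : ∀ i, φ s(x i, x (i + 1)) = e i := by
    intro i
    have := hfinj.extend_apply (Sum.elim (fun v => c v.1) e) 0 (Sum.inr i)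
    rw [← hφ, hf] at this
    exact this
  have φC' : ∀ i, φ s(x i, x (i - 1)) = e (i - 1) := by
    intro i
    rw [← φC, sub_add_cancel, Sym2.eq_swap]
  have φC2 : ∀ i, φ s(x (i + 1), x i) = e i := by
    intro i
    rw [← φC, Sym2.eq_swap]
  have φC2' : ∀ i, φ s(x (i - 1), x i) = e (i - 1) := by
    intro i
    rw [← φC', Sym2.eq_swap]
  have φt : ∀ i y, T.Adj (x i) y → φ s(x i, y) = tc i := by
    intro i y hy
    rw [hleaf i y (tn i) hy (htn i), ← hwe, φT _ (hw0 i), htc]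
  have hCx : ∀ a b, C.Adj a b → ∃ i, a = x i := by
    intro a b hab
    have : 0 < C.degree a := (C.degree_pos_iff_exists_adj a).2 ⟨b, hab⟩
    obtain ⟨i, hi⟩ := (hxd a).1 (by rcases h2 a with h | h <;> omega)
    exact ⟨i, hi.symm⟩
  have hEd : ∀ E ∈ H.edgeSet, φ E ∈ L E := by
    intro E
    induction E using Sym2.ind with
    | _ a b =>
      intro hab
      rw [mem_edgeSet, hH, sup_adj] at hab
      have tT : ∀ v, v ≠ r0 → φ s(v, par v) ∈ L s(v, par v) := by
        intro v hv
        rw [φT v hv]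
        have := c1 v hv
        rw [hL'] at this
        simpa [hv] using this
      rcases hab with hab | hab
      · rcases (hr.adj _ _).1 hab with ⟨k1, k2⟩ | ⟨k1, k2⟩
        · rw [k2]; exact tT a k1
        · rw [k2, Sym2.eq_swap]; exact tT b k1
      · obtain ⟨i, rfl⟩ := hCx a b hab
        rcases (hxadj i b).1 hab with rfl | rfl
        · rw [φC]; exact eL i
        · rw [φC', Sym2.eq_swap]
          have := eL (i - 1)
          rwa [sub_add_cancel] at this
  refine ⟨φ, hEd, ?_⟩
  rw [hH]
  have path3 : ∀ a b d, C.Adj a b → C.Adj b d → a ≠ d → ∃ j, b = x j ∧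
      ((a = x (j - 1) ∧ d = x (j + 1)) ∨ (a = x (j + 1) ∧ d = x (j - 1))) := by
    intro a b d hab hbd hne
    obtain ⟨j, rfl⟩ := hCx b d hbd
    refine ⟨j, rfl, ?_⟩
    rcases (hxadj j a).1 hab.symm with k1 | k1 <;> rcases (hxadj j d).1 hbd with k2 | k2
    · exact absurd (k1.trans k2.symm) hne
    · exact Or.inr ⟨k1, k2⟩
    · exact Or.inl ⟨k1, k2⟩
    · exact absurd (k1.trans k2.symm) hne
  apply hal_assemble T C φ R
  · -- F1
    intro a b y hab hy
    obtain ⟨i, rfl⟩ := hCx a b hab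
    rw [φt i y hy]
    rcases (hxadj i b).1 hab with rfl | rfl
    · rw [φC]; exact (en i).1.2.1
    · rw [φC']
      have := (en (i - 1)).1.2.2.1
      rwa [sub_add_cancel] at this
  · -- F2
    intro a b d y hab hbd hne hy
    obtain ⟨j, rfl, ⟨rfl, rfl⟩ | ⟨rfl, rfl⟩⟩ := path3 a b d hab hbd hne
    · rw [φt _ y hy, φC2']
      have := (en (j - 1)).1.2.2.2
      rwa [show j - 1 + 2 = j + 1 by ring] at this
    · rw [φt _ y hy, φC2]
      exact (en j).1.1
  · -- F3
    intro a b y u hab hy hyu hR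
    obtain ⟨i, rfl⟩ := hCx a b hab
    obtain rfl := hleaf i y (tn i) hy (htn i)
    have hm : φ s(tn i, u) ∈ A i := by
      rw [hA, hr.phi φT hyu]
      exact Finset.mem_image_of_mem _ (by simp [hyu, hR])
    intro hc
    rw [← hc] at hm
    rcases (hxadj i b).1 hab with rfl | rfl
    · rw [φC] at hm; exact (en i).2.1 hm
    · rw [φC'] at hm
      have := (en (i - 1)).2.2
      rw [sub_add_cancel] at this
      exact this hm
  · -- F4
    intro a b y z hab hy hz
    obtain ⟨i, rfl⟩ := hCx a b hab
    rw [φt i y hy]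
    rcases (hxadj i b).1 hab with rfl | rfl
    · rw [φt _ z hz]; exact htcne i
    · rw [φt _ z hz]
      have := htcne (i - 1)
      rw [sub_add_cancel] at this
      exact this.symm
  · -- F5
    intro a b d hab hbd hne
    have hee : ∀ j, e (j - 1) ≠ e j := by
      intro j
      have := e2 (j - 1)
      rwa [sub_add_cancel] at this
    obtain ⟨j, rfl, ⟨rfl, rfl⟩ | ⟨rfl, rfl⟩⟩ := path3 a b d hab hbd hne
    · rw [φC2', φC]; exact hee j
    · rw [φC2, φC']; exact (hee j).symm
  · -- F6
    intro a b m d f' hab hbm hmd hdf n1 n2 n3 q1 q2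
    have fin : ∀ j, e (j - 1 - 1) = e j → e (j - 1) = e (j + 1) → False := by
      intro j k1 k2
      apply e3 (j - 1 - 1)
      rw [show j - 1 - 1 + 2 = j by ring, show j - 1 - 1 + 1 = j - 1 by ring,
        show j - 1 - 1 + 3 = j + 1 by ring]
      exact ⟨k1, k2⟩
    have two' : ∀ j : ZMod l, x (j - 1) ≠ x (j + 1) := by
      intro j hj
      apply two
      linear_combination -(hx hj)
    obtain ⟨j, rfl, ⟨rfl, rfl⟩ | ⟨rfl, rfl⟩⟩ := path3 b m d hbm hmd n2
    · have ka : a = x (j - 1 - 1) := by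
        rcases (hxadj _ a).1 hab.symm with k | k
        · rw [sub_add_cancel] at k; exact absurd k n1
        · exact k
      have kf : f' = x (j + 1 + 1) := by
        rcases (hxadj _ f').1 hdf with k | k
        · exact k
        · rw [add_sub_cancel_right] at k; exact absurd k.symm n3
      rw [ka, φC2', φC] at q1
      rw [kf, φC2', φC] at q2
      exact fin j q1 q2
    · have ka : a = x (j + 1 + 1) := by
        rcases (hxadj _ a).1 hab.symm with k | k
        · exact k
        · rw [add_sub_cancel_right] at k; exact absurd k n1
      have kf : f' = x (j - 1 - 1) := by
        rcases (hxadj _ f').1 hdf with k | k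
        · rw [sub_add_cancel] at k; exact absurd k.symm n3
        · exact k
      rw [ka, φC2, φC'] at q1
      rw [kf, φC2, φC'] at q2
      exact fin j q2.symm q1.symm
  · -- F8
    intro a b u v hab hau hbv
    obtain ⟨i, rfl⟩ := hCx a u hau
    obtain ⟨j, rfl⟩ := hCx b v hbv
    exact hnon i j hab
  · exact hr.T1 φT hQ
  · exact hr.T2 φT hQ
  · intro x' y v u k1 k2 k3 k4 k5 k6
    exact hr.T3 φT hQ x' y v u k1 k2 k3 k4 k5 k6
  · intro y u v
    exact (hQ y).tot u v

theorem hx_degree {V : Type*} (G : SimpleGraph V) (v : V) [Fintype (G.neighborSet v)]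
    (s : Finset V) (hs : ∀ u, G.Adj v u ↔ u ∈ s) : G.degree v = s.card := by
  rw [← card_neighborFinset_eq_degree]
  congr 1
  ext u
  rw [mem_neighborFinset, hs]

/-- Vertices of the extremal graph: the root, its `d+1` children, and `d` leaves below each child. -/
abbrev HxV (d : ℕ) : Type := Option (Fin (d + 1) × Option (Fin d))

def hxPar (d : ℕ) : HxV d → HxV d
  | none => none
  | some (_, none) => none
  | some (i, some _) => some (i, none)

def hxT (d : ℕ) : SimpleGraph (HxV d) where
  Adj x y := x ≠ y ∧ (hxPar d x = y ∨ hxPar d y = x)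
  symm := ⟨fun _ _ h => ⟨h.1.symm, h.2.symm⟩⟩
  loopless := ⟨fun _ h => h.1 rfl⟩

def hxLeaf (d : ℕ) : Fin ((d + 1) * d) ↪ HxV d where
  toFun k := some ((finProdFinEquiv.symm k).1, some (finProdFinEquiv.symm k).2)
  inj' := by
    intro a b h
    simp only [Option.some.injEq, Prod.mk.injEq] at h
    exact finProdFinEquiv.symm.injective (Prod.ext h.1 h.2)

def hxC (d : ℕ) : SimpleGraph (HxV d) := (cycleGraph ((d + 1) * d)).map (hxLeaf d)

theorem hxT_adj (d : ℕ) (x y : HxV d) :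
    (hxT d).Adj x y ↔ x ≠ y ∧ (hxPar d x = y ∨ hxPar d y = x) := Iff.rfl

theorem hxLeaf_eq (d : ℕ) (i : Fin (d + 1)) (j : Fin d) :
    hxLeaf d (finProdFinEquiv (i, j)) = some (i, some j) := by
  have h : finProdFinEquiv.symm (finProdFinEquiv (i, j)) = (i, j) := Equiv.symm_apply_apply _ _
  change some ((finProdFinEquiv.symm (finProdFinEquiv (i, j))).1,
    some (finProdFinEquiv.symm (finProdFinEquiv (i, j))).2) = _
  rw [h]

theorem hxT_reach (d : ℕ) (x : HxV d) : (hxT d).Reachable x none := by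
  have h1 : ∀ i, (hxT d).Reachable (some (i, none)) none := fun i =>
    Adj.reachable (by rw [hxT_adj]; simp [hxPar])
  match x with
  | none => exact Reachable.refl _
  | some (i, none) => exact h1 i
  | some (i, some j) =>
    refine Reachable.trans (Adj.reachable ?_) (h1 i)
    rw [hxT_adj]; simp [hxPar]

theorem hxT_conn (d : ℕ) : (hxT d).Connected :=
  { preconnected := fun x y => (hxT_reach d x).trans (hxT_reach d y).symm
    nonempty := ⟨none⟩ }

theorem hxT_tree (d : ℕ) : (hxT d).IsTree := by
  rw [isTree_iff_connected_and_card]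
  refine ⟨hxT_conn d, le_antisymm ?_ (hxT_conn d).card_vert_le_card_edgeSet_add_one⟩
  have hsub : (hxT d).edgeSet ⊆
      Set.range (fun x : Fin (d + 1) × Option (Fin d) => s((some x : HxV d), hxPar d (some x))) := by
    intro e
    induction e with
    | h x y =>
      rw [mem_edgeSet, hxT_adj]
      rintro ⟨hne, h | h⟩
      · cases x with
        | none => exact absurd h hne
        | some x => exact ⟨x, by simp [h]⟩
      · cases y with
        | none => exact absurd h.symm hne
        | some y => exact ⟨y, by simp [h, Sym2.eq_swap]⟩
  have h1 := Set.ncard_le_ncard hsub (Set.toFinite _)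
  have h2 := Finite.card_range_le
    (fun x : Fin (d + 1) × Option (Fin d) => s((some x : HxV d), hxPar d (some x)))
  rw [Nat.card_coe_set_eq] at h2
  rw [Nat.card_coe_set_eq]
  have h3 : Nat.card (HxV d) = Nat.card (Fin (d + 1) × Option (Fin d)) + 1 := Finite.card_option
  omega

theorem hxT_deg_root (d : ℕ) : (hxT d).degree none = d + 1 := by
  rw [hx_degree _ _ (Finset.univ.image (fun i : Fin (d + 1) => (some (i, none) : HxV d)))]
  · rw [Finset.card_image_of_injective]
    · simp
    · intro a b h; simpa using h
  · intro u
    rw [hxT_adj]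
    rcases u with _ | ⟨i, _ | j⟩ <;> simp [hxPar]

theorem hxT_deg_mid (d : ℕ) (i : Fin (d + 1)) : (hxT d).degree (some (i, none)) = d + 1 := by
  rw [hx_degree _ _ (insert none
    (Finset.univ.image (fun j : Fin d => (some (i, some j) : HxV d))))]
  · rw [Finset.card_insert_of_notMem (by simp), Finset.card_image_of_injective]
    · simp
    · intro a b h; simpa using h
  · intro u
    rw [hxT_adj]
    rcases u with _ | ⟨i', _ | j⟩ <;> simp [hxPar]
    exact eq_comm

theorem hxT_deg_leaf (d : ℕ) (i : Fin (d + 1)) (j : Fin d) :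
    (hxT d).degree (some (i, some j)) = 1 := by
  rw [hx_degree _ _ {some (i, none)}]
  · simp
  · intro u
    rw [hxT_adj]
    rcases u with _ | ⟨i', _ | j⟩ <;> simp [hxPar]
    exact eq_comm

theorem hxC_deg_leaf (d : ℕ) (hd : 12 ≤ d) (i : Fin (d + 1)) (j : Fin d) :
    (hxC d).degree (some (i, some j)) = 2 := by
  rw [← hxLeaf_eq]
  rw [hx_degree _ _ (((cycleGraph ((d + 1) * d)).neighborFinset (finProdFinEquiv (i, j))).map
    (hxLeaf d))]
  · rw [Finset.card_map, card_neighborFinset_eq_degree]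
    obtain ⟨n, hn⟩ : ∃ n, (d + 1) * d = n + 3 := ⟨(d + 1) * d - 3, by
      have : 3 ≤ (d + 1) * d := by nlinarith
      omega⟩
    have key : ∀ (N : ℕ) (v : Fin N), N = n + 3 → (cycleGraph N).degree v = 2 := by
      intro N v h
      subst h
      have := cycleGraph_degree_three_le (n := n) (v := v)
      convert this
    exact key _ _ hn
  · intro u
    unfold hxC
    rw [map_adj, Finset.mem_map]
    constructor
    · rintro ⟨a, b, hab, h1, h2⟩
      rw [(hxLeaf d).injective h1] at hab
      exact ⟨b, by rw [mem_neighborFinset]; exact hab, h2⟩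
    · rintro ⟨b, hb, h2⟩
      rw [mem_neighborFinset] at hb
      exact ⟨_, b, hb, rfl, h2⟩

theorem hxC_adj (d : ℕ) (x y : HxV d) (h : (hxC d).Adj x y) :
    ∃ i j i' j', x = some (i, some j) ∧ y = some (i', some j') := by
  unfold hxC at h
  rw [map_adj] at h
  obtain ⟨a, b, -, rfl, rfl⟩ := h
  exact ⟨_, _, _, _, rfl, rfl⟩

theorem hxC_deg_root (d : ℕ) : (hxC d).degree none = 0 := by
  rw [hx_degree _ _ ∅]
  · simp
  · intro u
    simp only [Finset.notMem_empty, iff_false]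
    intro h
    obtain ⟨_, _, _, _, h1, -⟩ := hxC_adj d _ _ h
    simp at h1

theorem hxC_deg_mid (d : ℕ) (i : Fin (d + 1)) : (hxC d).degree (some (i, none)) = 0 := by
  rw [hx_degree _ _ ∅]
  · simp
  · intro u
    simp only [Finset.notMem_empty, iff_false]
    intro h
    obtain ⟨_, _, _, _, h1, -⟩ := hxC_adj d _ _ h
    simp at h1

theorem hxC_reach (d : ℕ) (i i' : Fin (d + 1)) (j j' : Fin d) :
    (hxC d).Reachable (some (i, some j)) (some (i', some j')) := by
  rw [← hxLeaf_eq, ← hxLeaf_eq]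
  have := cycleGraph_preconnected (finProdFinEquiv (i, j)) (finProdFinEquiv (i', j'))
  exact this.map (SimpleGraph.Embedding.map (hxLeaf d) _).toHom

theorem hx_gen (d : ℕ) (hd : 12 ≤ d) (H : SimpleGraph (HxV d)) (hH : H = hxT d ⊔ hxC d) :
    IsGenHalin H (hxT d) (hxC d) := by
  refine ⟨hxT_tree d, ?_, hH, ?_, ?_, ?_, ?_⟩
  · have := (hxT d).degree_le_maxDegree none
    rw [hxT_deg_root] at this
    omega
  · rw [Set.disjoint_left]
    intro e
    induction e with
    | h x y =>
      rw [mem_edgeSet, mem_edgeSet, hxT_adj]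
      intro h h'
      obtain ⟨_, _, _, _, rfl, rfl⟩ := hxC_adj d _ _ h'
      simp [hxPar] at h
  · intro v
    rcases v with _ | ⟨i, _ | j⟩
    · rw [hxT_deg_root, hxC_deg_root]; omega
    · rw [hxT_deg_mid, hxC_deg_mid]; omega
    · rw [hxT_deg_leaf, hxC_deg_leaf d hd]; omega
  · intro v
    rcases v with _ | ⟨i, _ | j⟩
    · rw [hxC_deg_root]; omega
    · rw [hxC_deg_mid]; omega
    · rw [hxC_deg_leaf d hd]; omega
  · intro u v hu hv
    rcases u with _ | ⟨i, _ | j⟩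
    · rw [hxC_deg_root] at hu; omega
    · rw [hxC_deg_mid] at hu; omega
    rcases v with _ | ⟨i', _ | j'⟩
    · rw [hxC_deg_root] at hv; omega
    · rw [hxC_deg_mid] at hv; omega
    exact hxC_reach d _ _ _ _

theorem hx_maxDegree (d : ℕ) (hd : 12 ≤ d) (H : SimpleGraph (HxV d)) (hH : H = hxT d ⊔ hxC d) :
    H.maxDegree = d + 1 := by
  have hle : ∀ v, (hxT d).degree v ≤ H.degree v := by
    intro v
    rw [← card_neighborFinset_eq_degree, ← card_neighborFinset_eq_degree]
    apply Finset.card_le_card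
    intro u hu
    rw [mem_neighborFinset] at hu ⊢
    rw [hH, sup_adj]; exact Or.inl hu
  have hle2 : ∀ v, H.degree v ≤ (hxT d).degree v + (hxC d).degree v := by
    intro v
    rw [← card_neighborFinset_eq_degree, ← card_neighborFinset_eq_degree,
      ← card_neighborFinset_eq_degree]
    refine le_trans (Finset.card_le_card ?_) (Finset.card_union_le _ _)
    intro u hu
    rw [mem_neighborFinset, hH, sup_adj] at hu
    rw [Finset.mem_union, mem_neighborFinset, mem_neighborFinset]
    exact hu
  apply le_antisymm
  · apply maxDegree_le_of_forall_degree_le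
    intro v
    have := hle2 v
    rcases v with _ | ⟨i, _ | j⟩
    · rw [hxT_deg_root, hxC_deg_root] at this; omega
    · rw [hxT_deg_mid, hxC_deg_mid] at this; omega
    · rw [hxT_deg_leaf, hxC_deg_leaf d hd] at this; omega
  · have h1 := hle none
    rw [hxT_deg_root] at h1
    exact h1.trans (H.degree_le_maxDegree none)

/-- A double counting lemma. -/
theorem hx_count (n : ℕ) (hn : 0 < n) (R : Fin n → Fin n → Prop)
    (hR : ∀ i j, i ≠ j → ¬ (R i j ∧ R j i)) (h0 : ∀ i, ¬ R i i) :
    ∃ i, (Finset.univ.filter (fun j => R i j)).card ≤ (n - 1) / 2 := by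
  by_contra hcon
  push Not at hcon
  have e : ∑ i, (Finset.univ.filter (fun j => R i j)).card
      = ∑ i, (Finset.univ.filter (fun j => R j i)).card := by
    simp only [Finset.card_filter]
    rw [Finset.sum_comm]
  have hle : ∀ i, (Finset.univ.filter (fun j => R i j)).card
      + (Finset.univ.filter (fun j => R j i)).card ≤ n - 1 := by
    intro i
    rw [← Finset.card_union_of_disjoint]
    · calc _ ≤ (Finset.univ.erase i).card := by
            apply Finset.card_le_card
            intro j hj
            rw [Finset.mem_erase]
            refine ⟨?_, Finset.mem_univ _⟩
            rintro rfl
            simp [h0] at hj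
        _ = n - 1 := by rw [Finset.card_erase_of_mem (Finset.mem_univ _)]; simp
    · rw [Finset.disjoint_left]
      intro j h1 h2
      simp only [Finset.mem_filter, Finset.mem_univ, true_and] at h1 h2
      by_cases hij : i = j
      · subst hij; exact h0 _ h1
      · exact hR i j hij ⟨h1, h2⟩
  have s1 : ∑ i : Fin n, ((Finset.univ.filter (fun j => R i j)).card
      + (Finset.univ.filter (fun j => R j i)).card) ≤ ∑ _i : Fin n, (n - 1) :=
    Finset.sum_le_sum fun i _ => hle i
  rw [Finset.sum_add_distrib, ← e] at s1
  have s2 : ∑ _i : Fin n, ((n - 1) / 2 + 1) ≤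
      ∑ i : Fin n, (Finset.univ.filter (fun j => R i j)).card :=
    Finset.sum_le_sum fun i _ => hcon i
  simp only [Finset.sum_const, Finset.card_univ, Fintype.card_fin, smul_eq_mul] at s1 s2
  have s3 : n * (2 * ((n - 1) / 2 + 1)) ≤ n * (n - 1) := by nlinarith
  have := Nat.le_of_mul_le_mul_left s3 hn
  omega

theorem hx_lower (d : ℕ) (hd : 12 ≤ d) (H : SimpleGraph (HxV d)) (hH : H = hxT d ⊔ hxC d)
    (k : ℕ) (hk : StarColorable H k) : 3 * (d + 1) / 2 ≤ k := by
  obtain ⟨φ, hφ, hprop, hpath, -⟩ := hk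
  let c : Fin (d + 1) → ℕ := fun i => φ s((none : HxV d), some (i, none))
  let l : Fin (d + 1) → Fin d → ℕ := fun i j => φ s((some (i, none) : HxV d), some (i, some j))
  have a1 : ∀ i, H.Adj none (some (i, none)) := fun i => by
    rw [hH, sup_adj, hxT_adj]; left; simp [hxPar]
  have a2 : ∀ i j, H.Adj (some (i, none)) (some (i, some j)) := fun i j => by
    rw [hH, sup_adj, hxT_adj]; left; simp [hxPar]
  have cinj : Function.Injective c := by
    intro i i' h
    by_contra hne
    refine hprop _ (a1 i) _ (a1 i') ⟨?_, none, by simp, by simp⟩ h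
    simp [hne]
  have linj : ∀ i, Function.Injective (l i) := by
    intro i j j' h
    by_contra hne
    refine hprop _ (a2 i j) _ (a2 i j') ⟨?_, some (i, none), by simp, by simp⟩ h
    simp [hne]
  have cl : ∀ i j, c i ≠ l i j := by
    intro i j h
    refine hprop _ (a1 i) _ (a2 i j) ⟨?_, some (i, none), by simp, by simp⟩ h
    simp
  obtain ⟨i, hi⟩ := hx_count (d + 1) (by omega) (fun i i' => ∃ j, l i j = c i') (by
    rintro i i' hne ⟨⟨j, hj⟩, ⟨j', hj'⟩⟩
    let p : H.Walk (some (i, some j)) (some (i', some j')) :=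
      Walk.cons (a2 i j).symm (Walk.cons (a1 i).symm (Walk.cons (a1 i')
        (Walk.cons (a2 i' j') Walk.nil)))
    refine hpath _ _ p ?_ rfl ⟨c i, c i', ?_⟩
    · simp [p, Walk.isPath_def, hne]
    · intro e he
      simp only [p, Walk.edges_cons, Walk.edges_nil, List.mem_cons, List.not_mem_nil,
        or_false] at he
      rcases he with rfl | rfl | rfl | rfl
      · right; rw [Sym2.eq_swap]; exact hj
      · left; rw [Sym2.eq_swap]
      · right; rfl
      · left; exact hj') (by
    rintro i ⟨j, hj⟩
    exact cl i j hj.symm)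
  have hA : (Finset.univ.image c).card = d + 1 := by
    rw [Finset.card_image_of_injective _ cinj]; simp
  have hB : (Finset.univ.image (l i)).card = d := by
    rw [Finset.card_image_of_injective _ (linj i)]; simp
  have hI : (Finset.univ.image c ∩ Finset.univ.image (l i)).card ≤ (d + 1 - 1) / 2 := by
    refine le_trans ?_ hi
    rw [← Finset.card_image_of_injective _ cinj]
    apply Finset.card_le_card
    intro x hx
    simp only [Finset.mem_inter, Finset.mem_image, Finset.mem_univ, true_and] at hx
    obtain ⟨⟨i', rfl⟩, j, hj⟩ := hx
    simp only [Finset.mem_image, Finset.mem_filter, Finset.mem_univ, true_and]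
    exact ⟨i', ⟨j, hj⟩, rfl⟩
  have hU : (Finset.univ.image c ∪ Finset.univ.image (l i)).card ≤ k := by
    rw [← Finset.card_range k]
    apply Finset.card_le_card
    intro x hx
    simp only [Finset.mem_union, Finset.mem_image, Finset.mem_univ, true_and] at hx
    rw [Finset.mem_range]
    rcases hx with ⟨i', rfl⟩ | ⟨j, rfl⟩
    · exact hφ _ (a1 i')
    · exact hφ _ (a2 i j)
  have := Finset.card_union_add_card_inter (Finset.univ.image c) (Finset.univ.image (l i))
  omega

theorem hx_choose_color {V : Type*} {G : SimpleGraph V} {k : ℕ} (h : StarChoosable G k) :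
    StarColorable G k := by
  obtain ⟨φ, h1, h2⟩ := h (fun _ => Finset.range k) (fun _ _ => by simp)
  exact ⟨φ, fun e he => Finset.mem_range.1 (h1 e he), h2⟩

theorem stmt_8 :
    (∀ (V : Type*) [Fintype V] (H T C : SimpleGraph V), IsGenHalin H T C →
      13 ≤ H.maxDegree → listStarChromaticIndex H ≤ 3 * H.maxDegree / 2) ∧
    (∀ Δ : ℕ, 13 ≤ Δ → ∃ (V : Type) (_ : Fintype V) (H T C : SimpleGraph V),
      IsGenHalin H T C ∧ H.maxDegree = Δ ∧
      listStarChromaticIndex H = 3 * Δ / 2 ∧ starChromaticIndex H = 3 * Δ / 2) := by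
  refine ⟨fun V _ H T C h hΔ => Nat.sInf_le (hal_upper h hΔ), ?_⟩
  intro Δ hΔ
  obtain ⟨d, rfl⟩ : ∃ d, Δ = d + 1 := ⟨Δ - 1, by omega⟩
  have hd : 12 ≤ d := by omega
  obtain ⟨H, hH⟩ : ∃ H, H = hxT d ⊔ hxC d := ⟨_, rfl⟩
  have hg := hx_gen d hd H hH
  have hm := hx_maxDegree d hd H hH
  have hu : StarChoosable H (3 * (d + 1) / 2) := by
    have := hal_upper hg (by omega)
    rwa [hm] at this
  refine ⟨HxV d, inferInstance, H, hxT d, hxC d, hg, hm, ?_, ?_⟩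
  · exact le_antisymm (Nat.sInf_le hu)
      (le_csInf ⟨_, hu⟩ fun k hk => hx_lower d hd H hH k (hx_choose_color hk))
  · exact le_antisymm (Nat.sInf_le (hx_choose_color hu))
      (le_csInf ⟨_, hx_choose_color hu⟩ fun k hk => hx_lower d hd H hH k hk)
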